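/- arXiv:2506.13669 — 2 statements merged into one kernel-verified Lean document; each statement's English description precedes it below -/
import Mathlib

section
/- Let n ∈ ℕ, s ∈ (1,∞)\ℕ and let A be a Young function. Assume that there are an admissible function φ and a constant c > 0 such that |u|_{𝓛^{φ}(ℝⁿ)} ≤ c |∇^{[s]}u|_{{s},A,ℝⁿ} for every u ∈ V^{s,A}_{d,1}(ℝⁿ). Then s ∈ (1, n+1)\ℕ and ∫_0 (t/A(t))^{(s−1)/(n+1−s)} dt < ∞ (i.e., the integral converges near 0). -/
open MeasureTheory Metric Set Filter
open scoped ENNReal Topology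

noncomputable section

/-- Euclidean space `ℝⁿ`. -/
abbrev Euc (n : ℕ) := EuclideanSpace ℝ (Fin n)

/-- A Young function: convex, left-continuous, vanishing at `0`,
non-constant on `(0,∞)`, with values in `[0,∞]`. -/
def IsYoung (A : ℝ → ℝ≥0∞) : Prop :=
  A 0 = 0 ∧
  (∀ x y t : ℝ, 0 ≤ x → 0 ≤ y → 0 ≤ t → t ≤ 1 →
      A (t * x + (1 - t) * y) ≤ ENNReal.ofReal t * A x + ENNReal.ofReal (1 - t) * A y) ∧
  (∀ t : ℝ, 0 < t → ContinuousWithinAt A (Set.Iic t) t) ∧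
  (∃ t₁ t₂ : ℝ, 0 < t₁ ∧ 0 < t₂ ∧ A t₁ ≠ A t₂)

/-- The right-continuous generalized inverse of a monotone function `A : [0,∞) → [0,∞]`. -/
def rcInv (A : ℝ → ℝ≥0∞) (v : ℝ≥0∞) : ℝ :=
  sInf {τ : ℝ | 0 ≤ τ ∧ v < A τ}

/-- The Young conjugate `Ã(t) = sup {τ t - A(τ) : τ ≥ 0}`. -/
def youngConj (A : ℝ → ℝ≥0∞) (t : ℝ) : ℝ≥0∞ :=
  ⨆ (τ : ℝ) (_ : 0 ≤ τ), ENNReal.ofReal (τ * t) - A τ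

/-- The functional `J_{σ,A}(v)` for a vector-valued `v`, with the Euclidean norm. -/
def Jfun (n : ℕ) (σ : ℝ) (A : ℝ → ℝ≥0∞) {ι : Type} [Fintype ι]
    (v : Euc n → ι → ℝ) : ℝ≥0∞ :=
  ∫⁻ x : Euc n, ∫⁻ y : Euc n,
    A (Real.sqrt (∑ i, (v x i - v y i) ^ 2) / ‖x - y‖ ^ σ) /
      ENNReal.ofReal (‖x - y‖ ^ (n : ℝ))

/-- The fractional Orlicz–Sobolev seminorm `|v|_{σ,A,ℝⁿ}` (vector-valued version). -/
def fracSem (n : ℕ) (σ : ℝ) (A : ℝ → ℝ≥0∞) {ι : Type} [Fintype ι]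
    (v : Euc n → ι → ℝ) : ℝ≥0∞ :=
  sInf (ENNReal.ofReal '' {lam : ℝ | 0 < lam ∧ Jfun n σ A (fun x i => v x i / lam) ≤ 1})

/-- The fractional Orlicz–Sobolev seminorm `|u|_{σ,A,ℝⁿ}` of a scalar function. -/
def fracSemS (n : ℕ) (σ : ℝ) (A : ℝ → ℝ≥0∞) (u : Euc n → ℝ) : ℝ≥0∞ :=
  fracSem n σ A (fun x (_ : Fin 1) => u x)

/-- The normalized mean oscillation `φ(|B|^{1/n})⁻¹ ⨍_B |u - u_B|` over the ball `B = B(x,r)`. -/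
def oscQuot (n : ℕ) (φ : ℝ → ℝ) (u : Euc n → ℝ) (x : Euc n) (r : ℝ) : ℝ :=
  (φ ((volume (ball x r)).toReal ^ ((n : ℝ)⁻¹)))⁻¹ *
    ⨍ y in ball x r, |u y - ⨍ z in ball x r, u z|

/-- The Campanato seminorm `|u|_{𝓛^φ(ℝⁿ)}`. -/
def campSem (n : ℕ) (φ : ℝ → ℝ) (u : Euc n → ℝ) : ℝ≥0∞ :=
  ⨆ (x : Euc n) (r : ℝ) (_ : 0 < r), ENNReal.ofReal (oscQuot n φ u x r)

/-- The Campanato quantity restricted to balls of measure at most `r`. -/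
def campSemSmall (n : ℕ) (φ : ℝ → ℝ) (u : Euc n → ℝ) (r : ℝ) : ℝ≥0∞ :=
  ⨆ (x : Euc n) (ρ : ℝ) (_ : 0 < ρ) (_ : volume (ball x ρ) ≤ ENNReal.ofReal r),
    ENNReal.ofReal (oscQuot n φ u x ρ)

/-- `φ : (0,∞) → (0,∞)` is admissible: positive and bounded below away from zero on `[a,∞)`. -/
def Admissible (φ : ℝ → ℝ) : Prop :=
  (∀ r : ℝ, 0 < r → 0 < φ r) ∧
  ∀ a : ℝ, 0 < a → ∃ ε : ℝ, 0 < ε ∧ ∀ r : ℝ, a ≤ r → ε ≤ φ r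

/-- `φ_{s,A}(r) = r^s A⁻¹(r^{-n})`. -/
def phiSA (n : ℕ) (s : ℝ) (A : ℝ → ℝ≥0∞) (r : ℝ) : ℝ :=
  r ^ s * rcInv A (ENNReal.ofReal (r ^ (-(n : ℝ))))

/-- `u` is `m`-times weakly differentiable, with iterated weak partial
derivatives recorded by `D`. -/
def HasWeakDerivs (n m : ℕ) (u : Euc n → ℝ)
    (D : (h : ℕ) → Euc n → (Fin h → Fin n) → ℝ) : Prop :=
  (∀ x d, D 0 x d = u x) ∧
  ∀ h : ℕ, h ≤ m → ∀ dirs : Fin h → Fin n,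
    LocallyIntegrable (fun x => D h x dirs) volume ∧
    ∀ φ : Euc n → ℝ, ContDiff ℝ (⊤ : ℕ∞) φ → HasCompactSupport φ →
      ∫ x : Euc n, u x *
          iteratedFDeriv ℝ h φ x (fun i => EuclideanSpace.single (dirs i) (1 : ℝ)) =
        (-1 : ℝ) ^ h * ∫ x : Euc n, D h x dirs * φ x

/-- The Euclidean length `|∇^h u|(x)` of the `h`-th order weak gradient. -/
def gradLen (n : ℕ) (D : (h : ℕ) → Euc n → (Fin h → Fin n) → ℝ) (h : ℕ) (x : Euc n) : ℝ :=
  Real.sqrt (∑ d : Fin h → Fin n, (D h x d) ^ 2)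

/-- The derivatives of orders `k, …, m` decay near infinity:
`|{|∇^h u| > t}| < ∞` for every `t > 0`. -/
def DecayFrom (n k m : ℕ) (D : (h : ℕ) → Euc n → (Fin h → Fin n) → ℝ) : Prop :=
  ∀ h : ℕ, k ≤ h → h ≤ m → ∀ t : ℝ, 0 < t →
    volume {x : Euc n | t < gradLen n D h x} < ⊤

/-- The Young function `F_k(t) = t^{n/(n-s+k+1)} ∫_0^t Ã(τ) τ^{-1-n/(n-s+k+1)} dτ`. -/
def Fk (n : ℕ) (s : ℝ) (k : ℕ) (A : ℝ → ℝ≥0∞) (t : ℝ) : ℝ≥0∞ :=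
  ENNReal.ofReal (t ^ ((n : ℝ) / ((n : ℝ) - s + (k : ℝ) + 1))) *
    ∫⁻ τ in Set.Ioc (0 : ℝ) t,
      youngConj A τ * ENNReal.ofReal (τ ^ (-1 - (n : ℝ) / ((n : ℝ) - s + (k : ℝ) + 1)))

/-- `ψ^k_{s,A}(r) = 1 / (r^{n-s+k} F_k⁻¹(r^{-n}))`. -/
def psiK (n : ℕ) (s : ℝ) (k : ℕ) (A : ℝ → ℝ≥0∞) (r : ℝ) : ℝ :=
  (r ^ ((n : ℝ) - s + (k : ℝ)) * rcInv (Fk n s k A) (ENNReal.ofReal (r ^ (-(n : ℝ)))))⁻¹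

/-- `ψ^{[s]}_{s,A}(r) = r^{{s}} A⁻¹(r^{-n})`. -/
def psiTop (n : ℕ) (s : ℝ) (A : ℝ → ℝ≥0∞) (r : ℝ) : ℝ :=
  r ^ (s - (⌊s⌋₊ : ℝ)) * rcInv A (ENNReal.ofReal (r ^ (-(n : ℝ))))

/-- Convergence near zero of `∫_0 (t/A(t))^{(s-(k+1))/(n-(s-(k+1)))} dt`. -/
def IntCondK (n : ℕ) (s : ℝ) (k : ℕ) (A : ℝ → ℝ≥0∞) : Prop :=
  ∃ ε : ℝ, 0 < ε ∧
    ∫⁻ t in Set.Ioc (0 : ℝ) ε,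
      (ENNReal.ofReal t / A t) ^ ((s - (k : ℝ) - 1) / ((n : ℝ) - (s - (k : ℝ) - 1))) < ⊤

/-- `P` is the projection polynomial `P^k_B[u]`: it has degree at most `k` and its
derivatives up to order `k` match, in the mean over `B`, the weak derivatives `D` of `u`. -/
def IsCampPoly (n k : ℕ) (D : (h : ℕ) → Euc n → (Fin h → Fin n) → ℝ)
    (B : Set (Euc n)) (P : MvPolynomial (Fin n) ℝ) : Prop :=
  P.totalDegree ≤ k ∧
  ∀ h : ℕ, h ≤ k → ∀ dirs : Fin h → Fin n,
    ∫ x in B, D h x dirs =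
      ∫ x in B,
        iteratedFDeriv ℝ h (fun y : Euc n => MvPolynomial.eval (fun i => y i) P) x
          (fun i => EuclideanSpace.single (dirs i) (1 : ℝ))

/-- The normalized oscillation of order `k` over the ball `B(x,r)`. -/
def oscQuotK (n k : ℕ) (φ : ℝ → ℝ) (u : Euc n → ℝ)
    (D : (h : ℕ) → Euc n → (Fin h → Fin n) → ℝ) (x : Euc n) (r : ℝ) : ℝ≥0∞ :=
  ⨅ (P : MvPolynomial (Fin n) ℝ) (_ : IsCampPoly n k D (ball x r) P),
    ENNReal.ofReal
      ((φ ((volume (ball x r)).toReal ^ ((n : ℝ)⁻¹)) *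
          (volume (ball x r)).toReal ^ ((k : ℝ) / (n : ℝ)))⁻¹ *
        ⨍ y in ball x r, |u y - MvPolynomial.eval (fun i => y i) P|)

/-- The `k`-th order Campanato seminorm `|u|_{𝓛^{k,φ}(ℝⁿ)}`. -/
def campSemK (n k : ℕ) (φ : ℝ → ℝ) (u : Euc n → ℝ)
    (D : (h : ℕ) → Euc n → (Fin h → Fin n) → ℝ) : ℝ≥0∞ :=
  ⨆ (x : Euc n) (r : ℝ) (_ : 0 < r), oscQuotK n k φ u D x r

/-- The `k`-th order Campanato quantity restricted to balls of measure at most `r`. -/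
def campSemKSmall (n k : ℕ) (φ : ℝ → ℝ) (u : Euc n → ℝ)
    (D : (h : ℕ) → Euc n → (Fin h → Fin n) → ℝ) (r : ℝ) : ℝ≥0∞ :=
  ⨆ (x : Euc n) (ρ : ℝ) (_ : 0 < ρ) (_ : volume (ball x ρ) ≤ ENNReal.ofReal r),
    oscQuotK n k φ u D x ρ

/-- The Luxemburg norm `‖f‖_{L^A(μ)}`. -/
def luxNorm {α : Type*} [MeasurableSpace α] (A : ℝ → ℝ≥0∞) (μ : Measure α)
    (f : α → ℝ) : ℝ≥0∞ :=
  sInf (ENNReal.ofReal '' {lam : ℝ | 0 < lam ∧ ∫⁻ x, A (|f x| / lam) ∂μ ≤ 1})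

/-- Iterated integral `∫_r^∞ ∫_{r_1}^∞ ⋯ g`. -/
def iterInt : ℕ → (ℝ → ℝ) → (ℝ → ℝ)
  | 0, g => g
  | j + 1, g => fun r => ∫ t in Set.Ioi r, iterInt j g t

end
section Young

theorem IsYoung.scale_le {A : ℝ → ℝ≥0∞} (hA : IsYoung A) {x t : ℝ} (hx : 0 ≤ x) (ht : 0 ≤ t)
    (ht1 : t ≤ 1) : A (t * x) ≤ ENNReal.ofReal t * A x := by
  have := hA.2.1 x 0 t hx le_rfl ht ht1
  simpa [hA.1] using this

theorem IsYoung.mono {A : ℝ → ℝ≥0∞} (hA : IsYoung A) {x y : ℝ} (hx : 0 ≤ x) (hxy : x ≤ y) :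
    A x ≤ A y := by
  rcases hx.eq_or_lt with rfl | hx
  · simp [hA.1]
  have hy : 0 < y := hx.trans_le hxy
  have h1 := hA.scale_le hy.le (div_nonneg hx.le hy.le) ((div_le_one hy).2 hxy)
  rw [div_mul_cancel₀ _ hy.ne'] at h1
  refine h1.trans (mul_le_of_le_one_left' ?_)
  exact ENNReal.ofReal_le_one.2 ((div_le_one hy).2 hxy)

theorem IsYoung.sum_le {A : ℝ → ℝ≥0∞} (hA : IsYoung A) (N : ℕ) :
    ∀ w b : ℕ → ℝ, (∀ k, 0 ≤ w k) → (∀ k, 0 ≤ b k) → ∑ k ∈ Finset.range N, w k ≤ 1 →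
      A (∑ k ∈ Finset.range N, w k * b k) ≤
        ∑ k ∈ Finset.range N, ENNReal.ofReal (w k) * A (b k) := by
  induction N with
  | zero => intro w b _ _ _; simp [hA.1]
  | succ N ih =>
    intro w b hw hb hs
    rw [Finset.sum_range_succ] at hs
    have hs0 : 0 ≤ ∑ k ∈ Finset.range N, w k := Finset.sum_nonneg fun k _ => hw k
    rw [Finset.sum_range_succ, Finset.sum_range_succ]
    rcases (show w N ≤ 1 by linarith).eq_or_lt with h1 | h1
    · have hz : ∀ k ∈ Finset.range N, w k = 0 :=
        (Finset.sum_eq_zero_iff_of_nonneg fun k _ => hw k).1 (by linarith)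
      rw [Finset.sum_congr rfl fun k hk => by rw [hz k hk, zero_mul]]
      simp [h1]
    · have hp : 0 < 1 - w N := by linarith
      set w' : ℕ → ℝ := fun k => w k / (1 - w N)
      have hw' : ∀ k, 0 ≤ w' k := fun k => div_nonneg (hw k) hp.le
      have e : ∑ k ∈ Finset.range N, w k * b k =
          (1 - w N) * ∑ k ∈ Finset.range N, w' k * b k := by
        rw [Finset.mul_sum]
        refine Finset.sum_congr rfl fun k _ => ?_
        simp only [w']; field_simp
      have e2 : ∑ k ∈ Finset.range N, ENNReal.ofReal (w k) * A (b k) =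
          ENNReal.ofReal (1 - w N) * ∑ k ∈ Finset.range N, ENNReal.ofReal (w' k) * A (b k) := by
        rw [Finset.mul_sum]
        refine Finset.sum_congr rfl fun k _ => ?_
        rw [← mul_assoc, ← ENNReal.ofReal_mul hp.le]
        congr 2
        simp only [w']; field_simp
      rw [e, e2]
      have h2 := hA.2.1 (b N) (∑ k ∈ Finset.range N, w' k * b k) (w N) (hb N)
        (Finset.sum_nonneg fun k _ => mul_nonneg (hw' k) (hb k)) (hw N) h1.le
      rw [add_comm]
      refine h2.trans ?_
      rw [add_comm]
      gcongr
      refine ih w' b hw' hb ?_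
      rw [← Finset.sum_div, div_le_one hp]
      linarith

theorem IsYoung.exists_pos_lt_top {A : ℝ → ℝ≥0∞} (hA : IsYoung A) :
    ∃ t₀ : ℝ, 0 < t₀ ∧ A t₀ < ⊤ := by
  obtain ⟨t₁, t₂, h1, h2, hne⟩ := hA.2.2.2
  by_contra! hcon
  exact hne ((top_le_iff.1 (hcon t₁ h1)).trans (top_le_iff.1 (hcon t₂ h2)).symm)

end Young

/-- The dyadic kernel `ρ ↦ min(1,ρ) / ρ^σ`. -/
noncomputable def dyadicKernel (σ ρ : ℝ) : ℝ := min 1 ρ / ρ ^ σ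

theorem dyadicKernel_nonneg {σ ρ : ℝ} (hρ : 0 ≤ ρ) : 0 ≤ dyadicKernel σ ρ :=
  div_nonneg (le_min zero_le_one hρ) (Real.rpow_nonneg hρ _)

theorem sum_dyadicKernel_le {σ : ℝ} (h0 : 0 < σ) (h1 : σ < 1) :
    ∃ B : ℝ, 0 < B ∧ ∀ (N : ℕ) (r : ℝ), 0 < r →
      ∑ k ∈ Finset.range N, dyadicKernel σ (((2 : ℝ) ^ k)⁻¹ * r) ≤ B := by
  have step : ∀ (N : ℕ) (r : ℝ),
      ∑ k ∈ Finset.range (N + 1), dyadicKernel σ (((2 : ℝ) ^ k)⁻¹ * r) =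
        (∑ k ∈ Finset.range N, dyadicKernel σ (((2 : ℝ) ^ k)⁻¹ * (r / 2))) +
          dyadicKernel σ r := by
    intro N r
    rw [Finset.sum_range_succ']
    simp only [pow_zero, inv_one, one_mul]
    congr 1
    refine Finset.sum_congr rfl fun k _ => ?_
    congr 1
    rw [pow_succ]; field_simp
  set q : ℝ := (2 : ℝ) ^ (1 - σ) with hq
  have hq1 : 1 < q := Real.one_lt_rpow one_lt_two (by linarith)
  set p : ℝ := (2 : ℝ) ^ σ with hp
  have hp1 : 1 < p := Real.one_lt_rpow one_lt_two h0
  set C : ℝ := q / (q - 1) with hC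
  have hCpos : 0 < C := div_pos (by linarith) (by linarith)
  have small : ∀ (N : ℕ) (r : ℝ), 0 < r →
      ∑ k ∈ Finset.range N, dyadicKernel σ (((2 : ℝ) ^ k)⁻¹ * r) ≤ C * r ^ (1 - σ) := by
    intro N
    induction N with
    | zero => intro r hr; simpa using mul_nonneg hCpos.le (Real.rpow_nonneg hr.le _)
    | succ N ih =>
      intro r hr
      rw [step]
      have h2 : dyadicKernel σ r ≤ r ^ (1 - σ) := by
        rw [dyadicKernel, Real.rpow_sub hr, Real.rpow_one]
        gcongr
        exact min_le_right _ _
      have h3 := ih (r / 2) (by positivity)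
      rw [Real.div_rpow hr.le (by norm_num), ← hq] at h3
      have : C * (r ^ (1 - σ) / q) + r ^ (1 - σ) = C * r ^ (1 - σ) := by
        have : q - 1 ≠ 0 := by linarith
        have : q ≠ 0 := by linarith
        rw [hC]; field_simp; ring
      linarith
  set D : ℝ := (p - 1)⁻¹ with hD
  have hDpos : 0 < D := inv_pos.2 (by linarith)
  have large : ∀ (N : ℕ) (r : ℝ), 1 ≤ r →
      ∑ k ∈ Finset.range N, dyadicKernel σ (((2 : ℝ) ^ k)⁻¹ * r) ≤ 1 + C + D - D * r ^ (-σ) := by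
    intro N
    induction N with
    | zero =>
      intro r hr
      have : r ^ (-σ) ≤ 1 := Real.rpow_le_one_of_one_le_of_nonpos hr (by linarith)
      simp only [Finset.range_zero, Finset.sum_empty]
      nlinarith
    | succ N ih =>
      intro r hr
      have hr0 : 0 < r := by linarith
      have hle : dyadicKernel σ r ≤ r ^ (-σ) := by
        rw [dyadicKernel, Real.rpow_neg hr0.le, ← one_div]
        gcongr
        exact min_le_left _ _
      have hone : r ^ (-σ) ≤ 1 := Real.rpow_le_one_of_one_le_of_nonpos hr (by linarith)
      rw [step]
      rcases le_or_gt 2 r with h2 | h2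
      · have h3 := ih (r / 2) (by linarith)
        have e : (r / 2) ^ (-σ) = p * r ^ (-σ) := by
          rw [Real.div_rpow hr0.le (by norm_num), Real.rpow_neg (by norm_num : (0:ℝ) ≤ 2), ← hp]
          field_simp
        rw [e] at h3
        have e2 : D * (p * r ^ (-σ)) = D * r ^ (-σ) + r ^ (-σ) := by
          have : p - 1 ≠ 0 := by linarith
          rw [hD]; field_simp; ring
        linarith
      · have h3 := small N (r / 2) (by positivity)
        have h4 : (r / 2) ^ (1 - σ) ≤ 1 :=
          Real.rpow_le_one (by positivity) (by linarith) (by linarith)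
        nlinarith
  refine ⟨1 + C + D, by positivity, fun N r hr => ?_⟩
  rcases le_or_gt 1 r with h | h
  · have := large N r h
    have : 0 ≤ D * r ^ (-σ) := mul_nonneg hDpos.le (Real.rpow_nonneg hr.le _)
    linarith
  · have h3 := small N r hr
    have h4 : r ^ (1 - σ) ≤ 1 := Real.rpow_le_one hr.le h.le (by linarith)
    nlinarith

theorem lintegral_dyadicKernel_lt_top {n : ℕ} (hn : 0 < n) {σ : ℝ} (h0 : 0 < σ) (h1 : σ < 1) :
    ∫⁻ z : Euc n, ENNReal.ofReal (dyadicKernel σ ‖z‖ / ‖z‖ ^ (n : ℝ)) < ⊤ := by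
  have : Nontrivial (Euc n) := by
    have : Nonempty (Fin n) := ⟨⟨0, hn⟩⟩
    infer_instance
  have hIntegrable : Integrable (fun z : Euc n => dyadicKernel σ ‖z‖ / ‖z‖ ^ (n : ℝ)) := by
    rw [integrable_fun_norm_addHaar (E := Euc n) volume
      (f := fun ρ : ℝ => dyadicKernel σ ρ / ρ ^ (n : ℝ))]
    rw [finrank_euclideanSpace_fin]
    have e : ∀ y : ℝ, 0 < y → y ^ (n - 1) • (dyadicKernel σ y / y ^ (n : ℝ)) =
        min 1 y * y ^ (-σ - 1) := by
      intro y hy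
      rw [dyadicKernel, Real.rpow_natCast, Real.rpow_sub hy, Real.rpow_neg hy.le, Real.rpow_one,
        smul_eq_mul]
      obtain ⟨j, rfl⟩ : ∃ j, n = j + 1 := ⟨n - 1, by omega⟩
      rw [Nat.add_sub_cancel, pow_succ]
      field_simp
    rw [← Ioc_union_Ioi_eq_Ioi (zero_le_one' ℝ), integrableOn_union]
    constructor
    · have h2 : IntegrableOn (fun y : ℝ => y ^ (-σ)) (Ioc 0 1) := by
        rw [← intervalIntegrable_iff_integrableOn_Ioc_of_le zero_le_one]
        exact intervalIntegral.intervalIntegrable_rpow' (by linarith)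
      refine h2.congr_fun (fun y hy => ?_) measurableSet_Ioc
      simp only
      rw [e y hy.1, min_eq_right hy.2, Real.rpow_sub hy.1, Real.rpow_one]
      field_simp [hy.1.ne']
    · have h2 : IntegrableOn (fun y : ℝ => y ^ (-σ - 1)) (Ioi 1) :=
        integrableOn_Ioi_rpow_of_lt (by linarith) one_pos
      refine h2.congr_fun (fun y hy => ?_) measurableSet_Ioi
      have hy' : (1 : ℝ) < y := hy
      simp only
      rw [e y (by linarith), min_eq_left hy'.le, one_mul]
  have := hIntegrable.lintegral_lt_top
  exact this

section SmoothCompactSupport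

variable {E : Type*} [NormedAddCommGroup E] [NormedSpace ℝ E]

theorem contDiff_iteratedFDeriv_apply {u : E → ℝ} (hu : ContDiff ℝ (⊤ : ℕ∞) u) (h : ℕ)
    (m : Fin h → E) : ContDiff ℝ (⊤ : ℕ∞) fun x => iteratedFDeriv ℝ h u x m := by
  have h1 : ContDiff ℝ (⊤ : ℕ∞) (iteratedFDeriv ℝ h u) := by
    refine hu.iteratedFDeriv_right (m := (⊤ : ℕ∞)) (i := h) ?_
    exact_mod_cast le_top
  exact (ContinuousMultilinearMap.apply ℝ (fun _ : Fin h => E) ℝ m).contDiff.comp h1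

theorem contDiff_fderiv_apply_const {u : E → ℝ} (hu : ContDiff ℝ (⊤ : ℕ∞) u) (v : E) :
    ContDiff ℝ (⊤ : ℕ∞) fun x => fderiv ℝ u x v := by
  have h1 : ContDiff ℝ (⊤ : ℕ∞) (fderiv ℝ u) :=
    hu.fderiv_right (m := (⊤ : ℕ∞)) (by exact_mod_cast le_top)
  exact h1.clm_apply contDiff_const

theorem iteratedFDeriv_succ_apply_eq_fderiv {u : E → ℝ} (hu : ContDiff ℝ (⊤ : ℕ∞) u) (h : ℕ)
    (m : Fin (h + 1) → E) (x : E) :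
    iteratedFDeriv ℝ (h + 1) u x m =
      fderiv ℝ (fun y => iteratedFDeriv ℝ h u y (Fin.tail m)) x (m 0) := by
  rw [iteratedFDeriv_succ_apply_left]
  have hd : DifferentiableAt ℝ (iteratedFDeriv ℝ h u) x :=
    (hu.differentiable_iteratedFDeriv (m := h) (by exact_mod_cast WithTop.coe_lt_top _)) x
  have := ((ContinuousMultilinearMap.apply ℝ (fun _ : Fin h => E) ℝ (Fin.tail m)).hasFDerivAt.comp
    x hd.hasFDerivAt).fderiv
  have h2 := congrArg (fun L : E →L[ℝ] ℝ => L (m 0)) this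
  exact h2.symm

theorem fderiv_fderiv_apply_comm {f : E → ℝ} (hf : ContDiff ℝ (⊤ : ℕ∞) f) (v w x : E) :
    fderiv ℝ (fun y => fderiv ℝ f y v) x w = fderiv ℝ (fun y => fderiv ℝ f y w) x v := by
  have hs : IsSymmSndFDerivAt ℝ f x := by
    refine hf.contDiffAt.isSymmSndFDerivAt ?_
    simp only [minSmoothness_of_isRCLikeNormedField]
    exact WithTop.coe_le_coe.2 (le_top (a := (2 : ℕ∞)))
  have hd : DifferentiableAt ℝ (fderiv ℝ f) x :=
    ((hf.fderiv_right (m := (⊤ : ℕ∞)) (by exact_mod_cast le_top)).differentiable (by simp)) x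
  have key : ∀ a b : E, fderiv ℝ (fun y => fderiv ℝ f y a) x b = fderiv ℝ (fderiv ℝ f) x b a := by
    intro a b
    rw [fderiv_clm_apply hd (differentiableAt_const a)]
    simp
  rw [key, key]
  exact hs.eq w v

theorem fderiv_iteratedFDeriv_apply {u : E → ℝ} (hu : ContDiff ℝ (⊤ : ℕ∞) u) (v : E) (h : ℕ) :
    ∀ (m : Fin h → E) (x : E), fderiv ℝ (fun y => iteratedFDeriv ℝ h u y m) x v =
      iteratedFDeriv ℝ h (fun y => fderiv ℝ u y v) x m := by
  induction h with
  | zero => intro m x; simp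
  | succ h ih =>
    intro m x
    simp_rw [iteratedFDeriv_succ_apply_eq_fderiv hu]
    rw [fderiv_fderiv_apply_comm (contDiff_iteratedFDeriv_apply hu h _),
      iteratedFDeriv_succ_apply_eq_fderiv (contDiff_fderiv_apply_const hu v)]
    simp_rw [ih]

theorem hasCompactSupport_iteratedFDeriv_apply {u : E → ℝ} (hu : HasCompactSupport u) (h : ℕ)
    (m : Fin h → E) : HasCompactSupport fun x => iteratedFDeriv ℝ h u x m :=
  (hu.iteratedFDeriv h).comp_left (g := fun L : E [×h]→L[ℝ] ℝ => L m) rfl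

variable [FiniteDimensional ℝ E] [MeasurableSpace E] [BorelSpace E]

theorem integral_mul_iteratedFDeriv_apply (μ : Measure E) [μ.IsAddHaarMeasure] {φ : E → ℝ}
    (hφ : ContDiff ℝ (⊤ : ℕ∞) φ) (h : ℕ) :
    ∀ {u : E → ℝ}, ContDiff ℝ (⊤ : ℕ∞) u → HasCompactSupport u → ∀ m : Fin h → E,
      ∫ x, u x * iteratedFDeriv ℝ h φ x m ∂μ =
        (-1 : ℝ) ^ h * ∫ x, iteratedFDeriv ℝ h u x m * φ x ∂μ := by
  induction h with
  | zero => intro u hu huc m; simp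
  | succ h ih =>
    intro u hu huc m
    have hF := contDiff_iteratedFDeriv_apply hφ h (Fin.tail m)
    have hu' := contDiff_fderiv_apply_const hu (m 0)
    have hF' := contDiff_fderiv_apply_const hF (m 0)
    have huc' : HasCompactSupport fun x => fderiv ℝ u x (m 0) := huc.fderiv_apply ℝ (m 0)
    simp_rw [iteratedFDeriv_succ_apply_eq_fderiv hφ]
    rw [integral_mul_fderiv_eq_neg_fderiv_mul_of_integrable]
    · rw [ih hu' huc' (Fin.tail m)]
      simp_rw [← fderiv_iteratedFDeriv_apply hu (m 0) h,
        iteratedFDeriv_succ_apply_eq_fderiv hu]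
      ring
    · exact (hu'.continuous.mul hF.continuous).integrable_of_hasCompactSupport huc'.mul_right
    · exact (hu.continuous.mul hF'.continuous).integrable_of_hasCompactSupport huc.mul_right
    · exact (hu.continuous.mul hF.continuous).integrable_of_hasCompactSupport huc.mul_right
    · exact fun x _ => hu.differentiable (by simp) x
    · exact fun x _ => hF.differentiable (by simp) x

end SmoothCompactSupport

/-- The family of all classical partial derivatives of `u`. -/
noncomputable def classicalDerivs (n : ℕ) (u : Euc n → ℝ) (h : ℕ) (x : Euc n) (d : Fin h → Fin n) : ℝ :=
  iteratedFDeriv ℝ h u x fun i => EuclideanSpace.single (d i) (1 : ℝ)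

theorem hasWeakDerivs_classicalDerivs (n m : ℕ) {u : Euc n → ℝ} (hu : ContDiff ℝ (⊤ : ℕ∞) u)
    (huc : HasCompactSupport u) : HasWeakDerivs n m u (classicalDerivs n u) := by
  refine ⟨fun x d => by simp [classicalDerivs], fun h _ dirs => ⟨?_, fun φ hφ _ => ?_⟩⟩
  · exact (contDiff_iteratedFDeriv_apply hu h _).continuous.locallyIntegrable
  · exact integral_mul_iteratedFDeriv_apply volume hφ h hu huc _

theorem decayFrom_classicalDerivs (n k m : ℕ) {u : Euc n → ℝ} (huc : HasCompactSupport u) :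
    DecayFrom n k m (classicalDerivs n u) := by
  intro h _ _ t ht
  refine lt_of_le_of_lt (measure_mono fun x hx => ?_) huc.measure_lt_top
  by_contra hxu
  have h0 : iteratedFDeriv ℝ h u x = 0 := by
    by_contra hne
    exact hxu (support_iteratedFDeriv_subset h hne)
  have : gradLen n (classicalDerivs n u) h x = 0 := by
    simp [gradLen, classicalDerivs, h0]
  simp only [mem_ofPred_eq, this] at hx
  exact absurd hx (not_lt.mpr ht.le)

theorem measurable_dyadicKernel (σ : ℝ) : Measurable (dyadicKernel σ) := by
  unfold dyadicKernel
  fun_prop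

/-- The radial kernel `z ↦ min(1,|z|/q) / ((|z|/q)^σ |z|^n)`. -/
noncomputable def radialKernel (n : ℕ) (σ q : ℝ) (z : Euc n) : ℝ≥0∞ :=
  ENNReal.ofReal (dyadicKernel σ (q⁻¹ * ‖z‖) / ‖z‖ ^ (n : ℝ))

theorem measurable_radialKernel (n : ℕ) (σ q : ℝ) : Measurable (radialKernel n σ q) := by
  unfold radialKernel
  have := measurable_dyadicKernel σ
  fun_prop

theorem lintegral_radialKernel (n : ℕ) (σ : ℝ) {q : ℝ} (hq : 0 < q) :
    ∫⁻ z, radialKernel n σ q z = ∫⁻ z, radialKernel n σ 1 z := by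
  have hqi : q⁻¹ ≠ 0 := inv_ne_zero hq.ne'
  have h1 : ∀ z, radialKernel n σ q z =
      ENNReal.ofReal ((q ^ n)⁻¹) * radialKernel n σ 1 (q⁻¹ • z) := by
    intro z
    rw [radialKernel, radialKernel, ← ENNReal.ofReal_mul (by positivity)]
    congr 1
    rw [norm_smul, Real.norm_of_nonneg (inv_nonneg.2 hq.le), Real.rpow_natCast, Real.rpow_natCast,
      mul_pow, inv_one, one_mul, inv_pow]
    have : q ^ n ≠ 0 := by positivity
    field_simp
  simp_rw [h1]
  have hm : Measurable fun z : Euc n => radialKernel n σ 1 (q⁻¹ • z) :=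
    (measurable_radialKernel n σ 1).comp (measurable_const_smul _)
  rw [lintegral_const_mul _ hm,
    ← lintegral_map (measurable_radialKernel n σ 1) (measurable_const_smul q⁻¹),
    Measure.map_addHaar_smul _ hqi, finrank_euclideanSpace_fin, lintegral_smul_measure, smul_eq_mul,
    ← mul_assoc, ← ENNReal.ofReal_mul (by positivity), inv_pow, inv_inv, abs_of_pos (by positivity),
    inv_mul_cancel₀ (by positivity), ENNReal.ofReal_one, one_mul]

theorem lintegral_lintegral_radialKernel_le (n : ℕ) (σ : ℝ) {q : ℝ} (hq : 0 < q) (R : ℝ) :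
    ∫⁻ x : Euc n, ∫⁻ y : Euc n, radialKernel n σ q (x - y) *
        ((ball (0 : Euc n) (q * R)).indicator 1 x + (ball (0 : Euc n) (q * R)).indicator 1 y) =
      2 * (∫⁻ z, radialKernel n σ 1 z) * (ENNReal.ofReal (q ^ n) * volume (ball (0 : Euc n) R)) := by
  set H := ∫⁻ z, radialKernel n σ 1 z
  set I : Euc n → ℝ≥0∞ := (ball (0 : Euc n) (q * R)).indicator 1
  have hI : Measurable I := measurable_one.indicator measurableSet_ball
  have hk := measurable_radialKernel n σ q
  have hneg : ∀ x y : Euc n, radialKernel n σ q (x - y) = radialKernel n σ q (y - x) := by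
    intro x y; simp only [radialKernel, norm_sub_rev]
  have hvol : ∫⁻ x, I x = ENNReal.ofReal (q ^ n) * volume (ball (0 : Euc n) R) := by
    rw [lintegral_indicator_one measurableSet_ball]
    have := Measure.addHaar_ball_mul_of_pos (volume : Measure (Euc n)) 0 hq R
    rw [finrank_euclideanSpace_fin] at this
    exact this
  have h1 : ∀ x : Euc n, ∫⁻ y, radialKernel n σ q (x - y) = H := by
    intro x
    simp_rw [hneg x]
    rw [lintegral_sub_right_eq_self, lintegral_radialKernel n σ hq]
  have h2 : ∀ y : Euc n, ∫⁻ x, radialKernel n σ q (x - y) = H := by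
    intro y
    rw [lintegral_sub_right_eq_self, lintegral_radialKernel n σ hq]
  simp_rw [mul_add]
  have hm : ∀ x : Euc n, Measurable fun y : Euc n => radialKernel n σ q (x - y) := fun x =>
    hk.comp (measurable_const.sub measurable_id)
  have hm2 : Measurable fun p : Euc n × Euc n => radialKernel n σ q (p.1 - p.2) :=
    hk.comp (measurable_fst.sub measurable_snd)
  have e1 : ∀ x : Euc n, ∫⁻ y, (radialKernel n σ q (x - y) * I x + radialKernel n σ q (x - y) * I y)
      = H * I x + ∫⁻ y, radialKernel n σ q (x - y) * I y := by
    intro x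
    rw [lintegral_add_left ((hm x).mul_const _), lintegral_mul_const _ (hm x), h1]
  simp_rw [e1]
  rw [lintegral_add_left (hI.const_mul _), lintegral_const_mul _ hI, lintegral_lintegral_swap]
  · have e2 : ∀ y : Euc n, ∫⁻ x, radialKernel n σ q (x - y) * I y = H * I y := by
      intro y
      have hmy : Measurable fun x : Euc n => radialKernel n σ q (x - y) :=
        hk.comp (measurable_id.sub measurable_const)
      rw [lintegral_mul_const _ hmy, h2]
    simp_rw [e2]
    rw [lintegral_const_mul _ hI, hvol]
    ring
  · exact (hm2.mul (hI.comp measurable_snd)).aemeasurable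

theorem sqrt_sum_sq_le_sum_abs {ι : Type*} (s : Finset ι) (f : ι → ℝ) :
    √(∑ i ∈ s, f i ^ 2) ≤ ∑ i ∈ s, |f i| := by
  refine Real.sqrt_le_iff.2 ⟨Finset.sum_nonneg fun i _ => abs_nonneg _, ?_⟩
  simp_rw [← sq_abs (f _)]
  exact Finset.sum_sq_le_sq_sum_of_nonneg fun i _ => abs_nonneg _

theorem dyadicSum_integrand_le {n : ℕ} {σ : ℝ} {A : ℝ → ℝ≥0∞} (hA : IsYoung A)
    {ι : Type} [Fintype ι] {W : Euc n → ι → ℝ} {C R B : ℝ}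
    (hC : 0 < C) (hWC : ∀ x y, ∑ d, |W x d - W y d| ≤ C * min 1 ‖x - y‖)
    (hWR : ∀ x, R ≤ ‖x‖ → W x = 0) (hB : 0 < B)
    (hsum : ∀ (N : ℕ) (r : ℝ), 0 < r →
      ∑ k ∈ Finset.range N, dyadicKernel σ (((2 : ℝ) ^ k)⁻¹ * r) ≤ B)
    (N : ℕ) {a : ℕ → ℝ} (ha : ∀ k, 0 ≤ a k) (x y : Euc n) :
    A (√(∑ d, ((∑ k ∈ Finset.range N, a k * ((2 : ℝ) ^ k) ^ σ * W (((2 : ℝ) ^ k)⁻¹ • x) d) -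
        ∑ k ∈ Finset.range N, a k * ((2 : ℝ) ^ k) ^ σ * W (((2 : ℝ) ^ k)⁻¹ • y) d) ^ 2) /
          ‖x - y‖ ^ σ) / ENNReal.ofReal (‖x - y‖ ^ (n : ℝ)) ≤
      ∑ k ∈ Finset.range N, ENNReal.ofReal B⁻¹ * A (C * B * a k) *
        (radialKernel n σ ((2 : ℝ) ^ k) (x - y) *
          ((ball (0 : Euc n) ((2 : ℝ) ^ k * R)).indicator 1 x +
            (ball (0 : Euc n) ((2 : ℝ) ^ k * R)).indicator 1 y)) := by
  set I : ℕ → Euc n → ℝ≥0∞ := fun k => (ball (0 : Euc n) ((2 : ℝ) ^ k * R)).indicator 1 with hI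
  rcases eq_or_ne x y with rfl | hxy
  · simp [hA.1]
  have hr : 0 < ‖x - y‖ := norm_pos_iff.2 (sub_ne_zero.2 hxy)
  set χ : ℕ → ℝ := fun k => if I k x + I k y = 0 then 0 else 1 with hχ
  have hχ0 : ∀ k, 0 ≤ χ k := fun k => by simp only [hχ]; split_ifs <;> norm_num
  have hχ1 : ∀ k, χ k ≤ 1 := fun k => by simp only [hχ]; split_ifs <;> norm_num
  have hχI : ∀ k, ENNReal.ofReal (χ k) ≤ I k x + I k y := by
    intro k
    simp only [hχ]
    split_ifs with h
    · simp
    · rw [ENNReal.ofReal_one]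
      have h01 : ∀ z, I k z = 0 ∨ I k z = 1 := fun z =>
        indicator_eq_zero_or_self (ball (0 : Euc n) ((2 : ℝ) ^ k * R)) 1 z
      rcases h01 x with hx | hx
      · rcases h01 y with hy | hy
        · exact absurd (by rw [hx, hy, add_zero]) h
        · rw [hy]; exact le_add_self
      · rw [hx]; exact le_self_add
  set w : ℕ → ℝ := fun k => dyadicKernel σ (((2 : ℝ) ^ k)⁻¹ * ‖x - y‖) * χ k / B with hw
  have hdk : ∀ k : ℕ, 0 ≤ dyadicKernel σ (((2 : ℝ) ^ k)⁻¹ * ‖x - y‖) := fun k =>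
    dyadicKernel_nonneg (by positivity)
  have hw0 : ∀ k, 0 ≤ w k := fun k => div_nonneg (mul_nonneg (hdk k) (hχ0 k)) hB.le
  have hw1 : ∑ k ∈ Finset.range N, w k ≤ 1 := by
    rw [← Finset.sum_div, div_le_one hB]
    refine le_trans (Finset.sum_le_sum fun k _ => ?_) (hsum N _ hr)
    exact mul_le_of_le_one_right (hdk k) (hχ1 k)
  have hWk : ∀ k : ℕ, ∑ d, |W (((2 : ℝ) ^ k)⁻¹ • x) d - W (((2 : ℝ) ^ k)⁻¹ • y) d| ≤
      C * min 1 (((2 : ℝ) ^ k)⁻¹ * ‖x - y‖) * χ k := by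
    intro k
    have hq : (0 : ℝ) < 2 ^ k := by positivity
    by_cases h : I k x + I k y = 0
    · have hz : ∀ z, I k z = 0 → W (((2 : ℝ) ^ k)⁻¹ • z) = 0 := by
        intro z hz
        refine hWR _ ?_
        rw [norm_smul, Real.norm_of_nonneg (by positivity), ← div_eq_inv_mul, le_div_iff₀ hq]
        by_contra! hlt
        have : z ∈ ball (0 : Euc n) ((2 : ℝ) ^ k * R) := by
          rw [mem_ball_zero_iff]; linarith
        simp [hI, indicator_of_mem this] at hz
      rw [add_eq_zero] at h
      rw [hz x h.1, hz y h.2]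
      simp only [Pi.zero_apply, sub_zero, abs_zero, Finset.sum_const_zero]
      exact mul_nonneg (mul_nonneg hC.le (le_min zero_le_one (by positivity))) (hχ0 k)
    · have := hWC (((2 : ℝ) ^ k)⁻¹ • x) (((2 : ℝ) ^ k)⁻¹ • y)
      rw [← smul_sub, norm_smul, Real.norm_of_nonneg (by positivity)] at this
      have hχk : χ k = 1 := if_neg h
      rwa [hχk, mul_one]
  have harg : √(∑ d, ((∑ k ∈ Finset.range N, a k * ((2 : ℝ) ^ k) ^ σ *
      W (((2 : ℝ) ^ k)⁻¹ • x) d) - ∑ k ∈ Finset.range N, a k * ((2 : ℝ) ^ k) ^ σ *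
        W (((2 : ℝ) ^ k)⁻¹ • y) d) ^ 2) / ‖x - y‖ ^ σ ≤
      ∑ k ∈ Finset.range N, w k * (C * B * a k) := by
    have hrσ : 0 < ‖x - y‖ ^ σ := Real.rpow_pos_of_pos hr _
    rw [div_le_iff₀ hrσ, Finset.sum_mul]
    refine (sqrt_sum_sq_le_sum_abs _ _).trans ?_
    calc ∑ d, |(∑ k ∈ Finset.range N, a k * ((2 : ℝ) ^ k) ^ σ * W (((2 : ℝ) ^ k)⁻¹ • x) d) -
          ∑ k ∈ Finset.range N, a k * ((2 : ℝ) ^ k) ^ σ * W (((2 : ℝ) ^ k)⁻¹ • y) d|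
        ≤ ∑ d, ∑ k ∈ Finset.range N, a k * ((2 : ℝ) ^ k) ^ σ *
            |W (((2 : ℝ) ^ k)⁻¹ • x) d - W (((2 : ℝ) ^ k)⁻¹ • y) d| := by
          refine Finset.sum_le_sum fun d _ => ?_
          rw [← Finset.sum_sub_distrib]
          refine (Finset.abs_sum_le_sum_abs _ _).trans (Finset.sum_le_sum fun k _ => ?_)
          rw [← mul_sub, abs_mul, abs_of_nonneg]
          exact mul_nonneg (ha k) (by positivity)
      _ = ∑ k ∈ Finset.range N, a k * ((2 : ℝ) ^ k) ^ σ *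
            ∑ d, |W (((2 : ℝ) ^ k)⁻¹ • x) d - W (((2 : ℝ) ^ k)⁻¹ • y) d| := by
          rw [Finset.sum_comm]
          simp_rw [Finset.mul_sum]
      _ ≤ ∑ k ∈ Finset.range N, w k * (C * B * a k) * ‖x - y‖ ^ σ := by
          refine Finset.sum_le_sum fun k _ => ?_
          refine (mul_le_mul_of_nonneg_left (hWk k)
            (mul_nonneg (ha k) (by positivity))).trans (le_of_eq ?_)
          simp only [hw, dyadicKernel]
          rw [Real.mul_rpow (by positivity) hr.le, Real.inv_rpow (by positivity)]
          have : (0 : ℝ) < ((2 : ℝ) ^ k) ^ σ := by positivity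
          field_simp
  have hA1 := (hA.mono (by positivity) harg).trans
    (hA.sum_le N w (fun k => C * B * a k) hw0
      (fun k => mul_nonneg (by positivity) (ha k)) hw1)
  rw [div_eq_mul_inv]
  refine (mul_le_mul_left hA1 _).trans ?_
  rw [Finset.sum_mul]
  refine Finset.sum_le_sum fun k _ => ?_
  have e : ENNReal.ofReal (w k) * (ENNReal.ofReal (‖x - y‖ ^ (n : ℝ)))⁻¹ =
      ENNReal.ofReal B⁻¹ * (radialKernel n σ ((2 : ℝ) ^ k) (x - y) * ENNReal.ofReal (χ k)) := by
    rw [radialKernel, ← ENNReal.ofReal_inv_of_pos (Real.rpow_pos_of_pos hr _),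
      ← ENNReal.ofReal_mul (hw0 k),
      ← ENNReal.ofReal_mul (div_nonneg (hdk k) (by positivity)),
      ← ENNReal.ofReal_mul (by positivity)]
    congr 1
    simp only [hw]
    ring
  calc ENNReal.ofReal (w k) * A (C * B * a k) * (ENNReal.ofReal (‖x - y‖ ^ (n : ℝ)))⁻¹
      = A (C * B * a k) *
        (ENNReal.ofReal (w k) * (ENNReal.ofReal (‖x - y‖ ^ (n : ℝ)))⁻¹) := by ring
    _ = ENNReal.ofReal B⁻¹ * A (C * B * a k) *
        (radialKernel n σ ((2 : ℝ) ^ k) (x - y) * ENNReal.ofReal (χ k)) := by rw [e]; ring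
    _ ≤ _ := by gcongr; exact hχI k

theorem Jfun_dyadicSum_le {n : ℕ} (hn : 0 < n) {σ : ℝ} (h0 : 0 < σ) (h1 : σ < 1)
    {A : ℝ → ℝ≥0∞} (hA : IsYoung A) {ι : Type} [Fintype ι] {W : Euc n → ι → ℝ} {C R : ℝ}
    (hC : 0 < C) (hWC : ∀ x y, ∑ d, |W x d - W y d| ≤ C * min 1 ‖x - y‖)
    (hWR : ∀ x, R ≤ ‖x‖ → W x = 0) :
    ∃ C₁ : ℝ, 0 < C₁ ∧ ∃ K : ℝ≥0∞, K < ⊤ ∧ ∀ (N : ℕ) (a : ℕ → ℝ), (∀ k, 0 ≤ a k) →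
      Jfun n σ A (fun x d => ∑ k ∈ Finset.range N,
        a k * ((2 : ℝ) ^ k) ^ σ * W (((2 : ℝ) ^ k)⁻¹ • x) d) ≤
      ∑ k ∈ Finset.range N, K * ENNReal.ofReal (((2 : ℝ) ^ k) ^ n) * A (C₁ * a k) := by
  obtain ⟨B, hB, hsum⟩ := sum_dyadicKernel_le h0 h1
  set H := ∫⁻ z, radialKernel n σ 1 z with hH
  have hHtop : H < ⊤ := by
    simpa [hH, radialKernel] using lintegral_dyadicKernel_lt_top hn h0 h1
  refine ⟨C * B, by positivity,
    ENNReal.ofReal B⁻¹ * (2 * H * volume (ball (0 : Euc n) R)), ?_, ?_⟩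
  · exact ENNReal.mul_lt_top ENNReal.ofReal_lt_top
      (ENNReal.mul_lt_top (ENNReal.mul_lt_top ENNReal.ofNat_lt_top hHtop) measure_ball_lt_top)
  intro N a ha
  set I : ℕ → Euc n → ℝ≥0∞ := fun k => (ball (0 : Euc n) ((2 : ℝ) ^ k * R)).indicator 1 with hI
  have hImeas : ∀ k, Measurable (I k) := fun k => measurable_one.indicator measurableSet_ball
  have hk := fun q => measurable_radialKernel n σ q
  have point := fun x y => dyadicSum_integrand_le hA hC hWC hWR hB hsum N ha x y
  have hm : ∀ k, Measurable fun p : Euc n × Euc n =>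
      radialKernel n σ ((2 : ℝ) ^ k) (p.1 - p.2) * (I k p.1 + I k p.2) := fun k =>
    ((hk _).comp (measurable_fst.sub measurable_snd)).mul
      (((hImeas k).comp measurable_fst).add ((hImeas k).comp measurable_snd))
  have hmx : ∀ k x, Measurable fun y : Euc n =>
      radialKernel n σ ((2 : ℝ) ^ k) (x - y) * (I k x + I k y) := fun k x =>
    ((hk _).comp (measurable_const.sub measurable_id)).mul (measurable_const.add (hImeas k))
  have e1 : ∀ x : Euc n, ∫⁻ y, ∑ k ∈ Finset.range N, ENNReal.ofReal B⁻¹ * A (C * B * a k) *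
        (radialKernel n σ ((2 : ℝ) ^ k) (x - y) * (I k x + I k y)) =
      ∑ k ∈ Finset.range N, ENNReal.ofReal B⁻¹ * A (C * B * a k) *
        ∫⁻ y, radialKernel n σ ((2 : ℝ) ^ k) (x - y) * (I k x + I k y) := by
    intro x
    rw [lintegral_finsetSum _ fun k _ => (hmx k x).const_mul _]
    exact Finset.sum_congr rfl fun k _ => lintegral_const_mul _ (hmx k x)
  rw [Jfun]
  refine (lintegral_mono fun x =>
    (lintegral_mono fun y => point x y).trans (e1 x).le).trans (le_of_eq ?_)
  rw [lintegral_finsetSum _ fun k _ => ((hm k).lintegral_prod_right').const_mul _]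
  refine Finset.sum_congr rfl fun k _ => ?_
  rw [lintegral_const_mul _ (hm k).lintegral_prod_right']
  rw [lintegral_lintegral_radialKernel_le n σ (by positivity) R]
  ring

theorem exists_smooth_cutoff_coordinate (n : ℕ) (i : Fin n) :
    ∃ w : Euc n → ℝ, ContDiff ℝ (⊤ : ℕ∞) w ∧ HasCompactSupport w ∧
      ∀ x ∈ ball (0 : Euc n) 1, w x = x i := by
  let η : ContDiffBump (0 : Euc n) := ⟨1, 2, one_pos, one_lt_two⟩
  have hcoord : ContDiff ℝ (⊤ : ℕ∞) fun x : Euc n => x i :=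
    (EuclideanSpace.proj (𝕜 := ℝ) i : Euc n →L[ℝ] ℝ).contDiff
  refine ⟨fun x => η x * x i, η.contDiff.mul hcoord, η.hasCompactSupport.mul_right,
    fun x hx => ?_⟩
  simp only
  rw [η.one_of_mem_closedBall (ball_subset_closedBall hx), one_mul]

theorem exists_bound_classicalDerivs (n m : ℕ) {w : Euc n → ℝ} (hw : ContDiff ℝ (⊤ : ℕ∞) w)
    (hwc : HasCompactSupport w) :
    ∃ C R : ℝ, 0 < C ∧
      (∀ x y, ∑ d, |classicalDerivs n w m x d - classicalDerivs n w m y d| ≤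
        C * min 1 ‖x - y‖) ∧
      ∀ x, R ≤ ‖x‖ → classicalDerivs n w m x = 0 := by
  have hs : ∀ d, ContDiff ℝ (⊤ : ℕ∞) fun x => classicalDerivs n w m x d := fun d =>
    contDiff_iteratedFDeriv_apply hw m _
  have hc : ∀ d, HasCompactSupport fun x => classicalDerivs n w m x d := fun d =>
    hasCompactSupport_iteratedFDeriv_apply hwc m _
  choose S hS using fun d => (hc d).exists_bound_of_continuous (hs d).continuous
  choose T hT using fun d => (hs d).lipschitzWith_of_hasCompactSupport (hc d) (by simp)
  obtain ⟨R, hR⟩ := hwc.isCompact.isBounded.subset_ball (0 : Euc n)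
  have hS0 : ∀ d, 0 ≤ S d := fun d => (norm_nonneg _).trans (hS d 0)
  refine ⟨∑ d, (2 * S d + T d) + 1, R, ?_, fun x y => ?_, fun x hx => ?_⟩
  · have : 0 ≤ ∑ d, (2 * S d + (T d : ℝ)) :=
      Finset.sum_nonneg fun d _ => by have := hS0 d; positivity
    linarith
  · have hm0 : 0 ≤ min 1 ‖x - y‖ := le_min zero_le_one (norm_nonneg _)
    rw [add_mul, Finset.sum_mul]
    refine le_add_of_le_of_nonneg (Finset.sum_le_sum fun d _ => ?_) (by linarith)
    have h1 : |classicalDerivs n w m x d - classicalDerivs n w m y d| ≤ 2 * S d := by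
      have hx := hS d x
      have hy := hS d y
      rw [Real.norm_eq_abs] at hx hy
      exact (abs_sub _ _).trans (by linarith)
    have h2 : |classicalDerivs n w m x d - classicalDerivs n w m y d| ≤ T d * ‖x - y‖ := by
      have := (hT d).dist_le_mul x y
      rwa [Real.dist_eq, dist_eq_norm] at this
    have hT0 : (0 : ℝ) ≤ T d := (T d).2
    have hSd := hS0 d
    rcases min_cases 1 ‖x - y‖ with ⟨e, _⟩ | ⟨e, _⟩ <;> rw [e]
    · linarith
    · nlinarith [norm_nonneg (x - y)]
  · have h0 : iteratedFDeriv ℝ m w x = 0 := by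
      by_contra hne
      have := hR (support_iteratedFDeriv_subset m hne)
      rw [mem_ball_zero_iff] at this
      linarith
    funext d
    simp [classicalDerivs, h0]

/-- The superposition `∑_{k<N} a_k 2^{ks} w(2^{-k} x)` of dilates of `w`. -/
noncomputable def dyadicSum {n : ℕ} (w : Euc n → ℝ) (s : ℝ) (N : ℕ) (a : ℕ → ℝ) (x : Euc n) : ℝ :=
  ∑ k ∈ Finset.range N, a k * ((2 : ℝ) ^ k) ^ s * w (((2 : ℝ) ^ k)⁻¹ • x)

section dyadicSum

variable {n : ℕ} {w : Euc n → ℝ} (s : ℝ) (N : ℕ) (a : ℕ → ℝ)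

theorem contDiff_dyadicSum (hw : ContDiff ℝ (⊤ : ℕ∞) w) :
    ContDiff ℝ (⊤ : ℕ∞) (dyadicSum w s N a) :=
  ContDiff.sum fun _ _ =>
    contDiff_const.mul (hw.comp (contDiff_const_smul _))

theorem hasCompactSupport_dyadicSum (hwc : HasCompactSupport w) :
    HasCompactSupport (dyadicSum w s N a) := by
  unfold dyadicSum
  induction N with
  | zero =>
    simp only [Finset.range_zero, Finset.sum_empty]
    exact HasCompactSupport.zero
  | succ N ih =>
    simp_rw [Finset.sum_range_succ]
    refine ih.add (HasCompactSupport.mul_left ?_)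
    exact hwc.comp_smul (inv_ne_zero (by positivity))

theorem classicalDerivs_dyadicSum (hw : ContDiff ℝ (⊤ : ℕ∞) w) (m : ℕ) :
    classicalDerivs n (dyadicSum w s N a) m = fun x d => ∑ k ∈ Finset.range N,
      a k * ((2 : ℝ) ^ k) ^ (s - m) * classicalDerivs n w m (((2 : ℝ) ^ k)⁻¹ • x) d := by
  funext x d
  have hcomp : ∀ k : ℕ, ContDiff ℝ m fun x : Euc n => w (((2 : ℝ) ^ k)⁻¹ • x) := fun k =>
    (hw.comp (contDiff_const_smul _)).of_le (by exact_mod_cast le_top)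
  have hterm : ∀ k : ℕ, ContDiff ℝ m fun x : Euc n =>
      (a k * ((2 : ℝ) ^ k) ^ s) • w (((2 : ℝ) ^ k)⁻¹ • x) := fun k => (hcomp k).const_smul _
  unfold classicalDerivs dyadicSum
  simp_rw [← smul_eq_mul (a := a _ * _) (b := w _)]
  rw [iteratedFDeriv_sum fun k _ => hterm k, Finset.sum_apply, _root_.sum_apply]
  refine Finset.sum_congr rfl fun k _ => ?_
  have hq : (0 : ℝ) < (2 : ℝ) ^ k := by positivity
  have e := iteratedFDeriv_const_smul_apply' (𝕜 := ℝ) (a := a k * ((2 : ℝ) ^ k) ^ s)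
    (x := x) (hcomp k).contDiffAt
  rw [e]
  have e2 := (((2 : ℝ) ^ k)⁻¹ • ContinuousLinearMap.id ℝ (Euc n)).iteratedFDeriv_comp_right
    (hw.of_le (m := m) (by exact_mod_cast le_top)) x (i := m) le_rfl
  have e3 : (w ∘ (((2 : ℝ) ^ k)⁻¹ • ContinuousLinearMap.id ℝ (Euc n))) =
      fun x => w (((2 : ℝ) ^ k)⁻¹ • x) := by
    funext z; simp
  rw [e3] at e2
  rw [e2]
  simp only [_root_.smul_apply,
    ContinuousMultilinearMap.compContinuousLinearMap_apply,
    ContinuousLinearMap.id_apply, smul_eq_mul]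
  rw [ContinuousMultilinearMap.map_smul_univ, Finset.prod_const, Finset.card_univ,
    Fintype.card_fin, smul_eq_mul, Real.rpow_sub hq, Real.rpow_natCast, inv_pow]
  ring

theorem dyadicSum_eq_on_ball {i : Fin n} (hw : ∀ x ∈ ball (0 : Euc n) 1, w x = x i) {x : Euc n}
    (hx : x ∈ ball (0 : Euc n) 1) :
    dyadicSum w s N a x = (∑ k ∈ Finset.range N, a k * ((2 : ℝ) ^ k) ^ (s - 1)) * x i := by
  rw [dyadicSum, Finset.sum_mul]
  refine Finset.sum_congr rfl fun k _ => ?_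
  have hq : (0 : ℝ) < (2 : ℝ) ^ k := by positivity
  have hq1 : (1 : ℝ) ≤ (2 : ℝ) ^ k := one_le_pow₀ one_le_two
  rw [mem_ball_zero_iff] at hx
  rw [hw, Real.rpow_sub_one hq.ne', PiLp.smul_apply, smul_eq_mul]
  · ring
  · rw [mem_ball_zero_iff, norm_smul, Real.norm_of_nonneg (by positivity)]
    exact (mul_le_of_le_one_left (norm_nonneg _) (inv_le_one_of_one_le₀ hq1)).trans_lt hx

end dyadicSum

theorem setAverage_abs_coordinate_pos {n : ℕ} (i : Fin n) (c : ℝ) :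
    0 < ⨍ y in ball (0 : Euc n) 1, |y i - c| := by
  have hcont : Continuous fun y : Euc n => |y i - c| := by fun_prop
  rw [setAverage_eq, smul_eq_mul]
  refine mul_pos (inv_pos.2 ?_) ?_
  · exact ENNReal.toReal_pos (measure_ball_pos _ _ one_pos).ne' measure_ball_lt_top.ne
  have hIntegrable : IntegrableOn (fun y : Euc n => |y i - c|) (ball 0 1) :=
    (hcont.continuousOn.integrableOn_compact (isCompact_closedBall 0 1)).mono_set
      ball_subset_closedBall
  rw [setIntegral_pos_iff_support_of_nonneg_ae (ae_of_all _ fun y => abs_nonneg _) hIntegrable]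
  have hopen : IsOpen (Function.support (fun y : Euc n => |y i - c|) ∩ ball 0 1) :=
    hcont.isOpen_support.inter isOpen_ball
  refine hopen.measure_pos _ ?_
  by_cases hc : c = 0
  · refine ⟨EuclideanSpace.single i (1 / 2), ?_, ?_⟩
    · simp [hc]
    · rw [mem_ball_zero_iff, PiLp.norm_single]; norm_num
  · refine ⟨0, ?_, by simp⟩
    simpa using hc

/-- The duality inequality tested by superpositions of dilates of one linear profile. -/
theorem exists_dyadic_duality_bound {n : ℕ} (hn : 0 < n) {s : ℝ} (hs1 : 1 < s)
    (hs2 : ∀ m : ℕ, s ≠ (m : ℝ)) {A : ℝ → ℝ≥0∞} (hA : IsYoung A)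
    (h : ∃ (φ : ℝ → ℝ) (c : ℝ), Admissible φ ∧ 0 < c ∧
      ∀ (u : Euc n → ℝ) (D : (h : ℕ) → Euc n → (Fin h → Fin n) → ℝ),
        HasWeakDerivs n ⌊s⌋₊ u D → DecayFrom n 1 ⌊s⌋₊ D →
        fracSem n (s - (⌊s⌋₊ : ℝ)) A (D ⌊s⌋₊) < ⊤ →
        campSem n φ u ≤ ENNReal.ofReal c * fracSem n (s - (⌊s⌋₊ : ℝ)) A (D ⌊s⌋₊)) :
    ∃ M K : ℝ, 0 < M ∧ 0 < K ∧ ∀ (N : ℕ) (b : ℕ → ℝ), (∀ k, 0 ≤ b k) →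
      ∑ k ∈ Finset.range N, ENNReal.ofReal (((2 : ℝ) ^ k) ^ n) * A (b k) ≤ ENNReal.ofReal K →
      ∑ k ∈ Finset.range N, b k * ((2 : ℝ) ^ k) ^ (s - 1) ≤ M := by
  obtain ⟨φ, c, hφ, hc, hemb⟩ := h
  set m := ⌊s⌋₊ with hm
  have hσ0 : 0 < s - m :=
    sub_pos.2 (lt_of_le_of_ne (Nat.floor_le (by linarith)) (hs2 m).symm)
  have hσ1 : s - m < 1 := by have := Nat.lt_floor_add_one s; rw [← hm] at this; linarith
  set i : Fin n := ⟨0, hn⟩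
  obtain ⟨w, hw, hwc, hwi⟩ := exists_smooth_cutoff_coordinate n i
  obtain ⟨C, R, hC, hWC, hWR⟩ := exists_bound_classicalDerivs n m hw hwc
  obtain ⟨C₁, hC₁, K, hK, hJ⟩ := Jfun_dyadicSum_le hn hσ0 hσ1 hA hC hWC hWR
  set κ : ℝ := ⨍ y in ball (0 : Euc n) 1, |y i - ⨍ z in ball (0 : Euc n) 1, z i| with hκdef
  have hκ : 0 < κ := setAverage_abs_coordinate_pos i _
  set Φ : ℝ := φ ((volume (ball (0 : Euc n) 1)).toReal ^ ((n : ℝ)⁻¹))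
  have hΦ : 0 < Φ := hφ.1 _ (Real.rpow_pos_of_pos
    (ENNReal.toReal_pos (measure_ball_pos _ _ one_pos).ne' measure_ball_lt_top.ne) _)
  refine ⟨C₁ * (c * Φ / κ), (K.toReal + 1)⁻¹, by positivity, by positivity, fun N b hb hsum => ?_⟩
  set a : ℕ → ℝ := fun k => b k / C₁ with ha
  have ha0 : ∀ k, 0 ≤ a k := fun k => div_nonneg (hb k) hC₁.le
  set S : ℝ := ∑ k ∈ Finset.range N, a k * ((2 : ℝ) ^ k) ^ (s - 1) with hS
  have hS0 : 0 ≤ S := Finset.sum_nonneg fun k _ => mul_nonneg (ha0 k) (by positivity)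
  have hbS : ∑ k ∈ Finset.range N, b k * ((2 : ℝ) ^ k) ^ (s - 1) = C₁ * S := by
    rw [hS, Finset.mul_sum]
    refine Finset.sum_congr rfl fun k _ => ?_
    simp only [ha]; field_simp
  rw [hbS]
  refine mul_le_mul_of_nonneg_left ?_ hC₁.le
  set u := dyadicSum w s N a with hu
  have hJ1 : Jfun n (s - m) A (classicalDerivs n u m) ≤ 1 := by
    rw [hu, classicalDerivs_dyadicSum s N a hw m]
    refine (hJ N a ha0).trans ?_
    have e : ∀ k, C₁ * a k = b k := fun k => by simp only [ha]; field_simp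
    simp_rw [e, mul_assoc]
    rw [← Finset.mul_sum]
    refine (mul_le_mul_right hsum K).trans ?_
    rw [← ENNReal.ofReal_toReal hK.ne, ← ENNReal.ofReal_mul ENNReal.toReal_nonneg,
      ENNReal.toReal_ofReal ENNReal.toReal_nonneg]
    refine ENNReal.ofReal_le_one.2 ?_
    rw [← div_eq_mul_inv, div_le_one (by positivity)]
    linarith
  have hsem : fracSem n (s - m) A (classicalDerivs n u m) ≤ 1 := by
    refine sInf_le ⟨1, ⟨one_pos, ?_⟩, ENNReal.ofReal_one⟩
    simpa only [div_one] using hJ1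
  have hcamp := hemb u (classicalDerivs n u)
    (hasWeakDerivs_classicalDerivs n m (contDiff_dyadicSum s N a hw)
      (hasCompactSupport_dyadicSum s N a hwc))
    (decayFrom_classicalDerivs n 1 m (hasCompactSupport_dyadicSum s N a hwc))
    (hsem.trans_lt ENNReal.one_lt_top)
  have hosc : ENNReal.ofReal (oscQuot n φ u 0 1) ≤ ENNReal.ofReal c := by
    calc ENNReal.ofReal (oscQuot n φ u 0 1) ≤ campSem n φ u :=
          le_iSup₂_of_le 0 1 (le_iSup_of_le one_pos le_rfl)
      _ ≤ _ := hcamp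
      _ ≤ ENNReal.ofReal c * 1 := mul_le_mul_right hsem _
      _ = _ := mul_one _
  rw [ENNReal.ofReal_le_ofReal_iff hc.le] at hosc
  have hue : oscQuot n φ u 0 1 = Φ⁻¹ * (S * κ) := by
    have e1 : ⨍ z in ball (0 : Euc n) 1, u z = S * ⨍ z in ball (0 : Euc n) 1, z i := by
      rw [setAverage_congr_fun measurableSet_ball
        (ae_of_all _ fun x hx => dyadicSum_eq_on_ball s N a hwi hx)]
      simp only [setAverage_eq, integral_const_mul, smul_eq_mul, ← hS]
      ring
    rw [oscQuot, e1]
    congr 1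
    rw [setAverage_congr_fun (g := fun y : Euc n => S * |y i - ⨍ z in ball (0 : Euc n) 1, z i|)
      measurableSet_ball (ae_of_all _ fun x hx => ?_)]
    · rw [hκdef]
      simp only [setAverage_eq, integral_const_mul, smul_eq_mul]
      ring
    · simp only
      rw [hu, dyadicSum_eq_on_ball s N a hwi hx, ← hS, ← mul_sub, abs_mul, abs_of_nonneg hS0]
  rw [hue, inv_mul_le_iff₀ hΦ] at hosc
  rw [le_div_iff₀ hκ]
  linarith

theorem lt_of_dyadic_duality_bound {n : ℕ} {s : ℝ} (hs2 : ∀ m : ℕ, s ≠ (m : ℝ))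
    {A : ℝ → ℝ≥0∞} (hA : IsYoung A) {M K : ℝ} (hK : 0 < K)
    (h : ∀ (N : ℕ) (b : ℕ → ℝ), (∀ k, 0 ≤ b k) →
      ∑ k ∈ Finset.range N, ENNReal.ofReal (((2 : ℝ) ^ k) ^ n) * A (b k) ≤ ENNReal.ofReal K →
      ∑ k ∈ Finset.range N, b k * ((2 : ℝ) ^ k) ^ (s - 1) ≤ M) :
    s < (n : ℝ) + 1 := by
  by_contra! hcon
  have hlt : (n : ℝ) + 1 < s :=
    lt_of_le_of_ne hcon fun e => hs2 (n + 1) (by push_cast; exact e.symm)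
  obtain ⟨t₀, ht₀, hAt⟩ := hA.exists_pos_lt_top
  set α := (A t₀).toReal with hα
  have hα0 : 0 ≤ α := ENNReal.toReal_nonneg
  set θ : ℝ := min 1 (K / (α + 1)) with hθ
  have hθ0 : 0 < θ := lt_min one_pos (by positivity)
  have hθ1 : θ ≤ 1 := min_le_left _ _
  have hθK : θ * α ≤ K := by
    have : θ ≤ K / (α + 1) := min_le_right _ _
    rw [le_div_iff₀ (by positivity)] at this
    nlinarith
  have key : ∀ j : ℕ, θ * t₀ * ((2 : ℝ) ^ (s - 1 - n)) ^ j ≤ M := by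
    intro j
    set b : ℕ → ℝ := fun k => if k = j then θ * (((2 : ℝ) ^ j) ^ n)⁻¹ * t₀ else 0 with hb
    have hb0 : ∀ k, 0 ≤ b k := fun k => by simp only [hb]; split_ifs <;> positivity
    have hq : (0 : ℝ) < (2 : ℝ) ^ j := by positivity
    have := h (j + 1) b hb0 ?_
    · refine le_trans (le_of_eq ?_) ((Finset.single_le_sum (f := fun k =>
        b k * ((2 : ℝ) ^ k) ^ (s - 1)) (fun k _ => mul_nonneg (hb0 k) (by positivity))
          (Finset.self_mem_range_succ j)).trans this)
      simp only [hb, if_true]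
      rw [← Real.rpow_natCast ((2 : ℝ) ^ (s - 1 - n)) j, ← Real.rpow_mul zero_le_two,
        mul_comm _ (j : ℝ),
        Real.rpow_mul zero_le_two, Real.rpow_natCast, Real.rpow_sub hq, Real.rpow_natCast]
      field_simp
    · rw [Finset.sum_eq_single_of_mem j (Finset.self_mem_range_succ j)
        fun k _ hk => by simp [hb, hk, hA.1]]
      simp only [hb, if_true]
      have hc1 : θ * (((2 : ℝ) ^ j) ^ n)⁻¹ ≤ 1 :=
        mul_le_one₀ hθ1 (by positivity)
          (inv_le_one_of_one_le₀ (one_le_pow₀ (one_le_pow₀ one_le_two)))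
      refine (mul_le_mul_right (hA.scale_le ht₀.le (by positivity) hc1) _).trans ?_
      rw [← ENNReal.ofReal_toReal hAt.ne, ← ENNReal.ofReal_mul (by positivity),
        ← ENNReal.ofReal_mul (by positivity)]
      refine ENNReal.ofReal_le_ofReal (le_trans (le_of_eq ?_) hθK)
      rw [← hα]
      field_simp
  have hbase : 1 < (2 : ℝ) ^ (s - 1 - n) := Real.one_lt_rpow one_lt_two (by linarith)
  obtain ⟨j, hj⟩ := pow_unbounded_of_one_lt (M / (θ * t₀)) hbase
  rw [div_lt_iff₀ (by positivity)] at hj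
  linarith [key j]

/-- The points of `(0,1]` at which `A(t)/t` does not exceed `c`. -/
def slopeSublevel (A : ℝ → ℝ≥0∞) (c : ℝ) : Set ℝ :=
  {t | t ∈ Ioc (0 : ℝ) 1 ∧ A t ≤ ENNReal.ofReal (c * t)}

theorem IsYoung.slopeSublevel_of_le {A : ℝ → ℝ≥0∞} (hA : IsYoung A) {c x y : ℝ} (hx : 0 < x)
    (hxy : x ≤ y) (hy : y ∈ slopeSublevel A c) : x ∈ slopeSublevel A c := by
  have hy0 : 0 < y := hx.trans_le hxy
  refine ⟨⟨hx, hxy.trans hy.1.2⟩, ?_⟩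
  have h1 := hA.scale_le hy0.le (div_nonneg hx.le hy0.le) ((div_le_one hy0).2 hxy)
  rw [div_mul_cancel₀ _ hy0.ne'] at h1
  refine h1.trans ((mul_le_mul_right hy.2 _).trans (le_of_eq ?_))
  rw [← ENNReal.ofReal_mul (by positivity)]
  congr 1
  field_simp

theorem IsYoung.measurableSet_slopeSublevel {A : ℝ → ℝ≥0∞} (hA : IsYoung A) (c : ℝ) :
    MeasurableSet (slopeSublevel A c) := by
  refine OrdConnected.measurableSet ⟨fun x hx y hy z hz => ?_⟩
  exact hA.slopeSublevel_of_le (hx.1.1.trans_le hz.1) hz.2 hy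

theorem exists_mem_slopeSublevel_ge (A : ℝ → ℝ≥0∞) (c : ℝ) :
    ∃ b : ℝ, 0 ≤ b ∧ (b = 0 ∨ b ∈ slopeSublevel A c) ∧
      volume (slopeSublevel A c) ≤ ENNReal.ofReal (2 * b) := by
  have hfin : volume (slopeSublevel A c) < ⊤ :=
    (measure_mono fun t ht => ht.1).trans_lt (measure_Ioc_lt_top (a := (0 : ℝ)) (b := 1))
  set v := (volume (slopeSublevel A c)).toReal with hv
  have hveq : volume (slopeSublevel A c) = ENNReal.ofReal v := (ENNReal.ofReal_toReal hfin.ne).symm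
  rcases (ENNReal.toReal_nonneg : 0 ≤ v).eq_or_lt with h0 | h0
  · exact ⟨0, le_rfl, Or.inl rfl, by rw [hveq, show v = 0 from h0.symm]; simp⟩
  by_contra! hcon
  have hsub : slopeSublevel A c ⊆ Ioc 0 (v / 2) := by
    intro t ht
    refine ⟨ht.1.1, ?_⟩
    have := hcon t ht.1.1.le (Or.inr ht)
    rw [hveq, ENNReal.ofReal_lt_ofReal_iff h0] at this
    linarith
  have := measure_mono (μ := volume) hsub
  rw [hveq, Real.volume_Ioc, ENNReal.ofReal_le_ofReal_iff (by linarith)] at this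
  linarith

theorem rpow_div_le_dyadic {A : ℝ → ℝ≥0∞} {β γ lam : ℝ} (hβ : 0 < β) (hγ : 0 < γ)
    (hlam : 0 < lam) {t : ℝ} (ht : t ∈ Ioc (0 : ℝ) 1) :
    (ENNReal.ofReal t / A t) ^ (β / γ) ≤ ENNReal.ofReal (lam⁻¹ ^ (β / γ)) +
      ENNReal.ofReal (lam⁻¹ ^ (β / γ) * 2 ^ β) * ∑' k : ℕ,
        (slopeSublevel A (lam * (((2 : ℝ) ^ k) ^ γ)⁻¹)).indicator
          (fun _ => ENNReal.ofReal (((2 : ℝ) ^ k) ^ β)) t := by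
  have hβγ : 0 < β / γ := div_pos hβ hγ
  have ht0 := ht.1
  have hpos : 0 < lam⁻¹ ^ (β / γ) := by positivity
  have bound : ∀ c : ℝ, 0 < c → ENNReal.ofReal (c * t) < A t →
      (ENNReal.ofReal t / A t) ^ (β / γ) ≤ ENNReal.ofReal (c⁻¹ ^ (β / γ)) := by
    intro c hc hlt
    rw [← ENNReal.ofReal_rpow_of_pos (inv_pos.2 hc)]
    refine ENNReal.rpow_le_rpow ?_ hβγ.le
    refine (ENNReal.div_le_div_left hlt.le _).trans (le_of_eq ?_)
    rw [← ENNReal.ofReal_div_of_pos (by positivity)]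
    congr 1
    field_simp
  by_cases h0 : ∃ k : ℕ, t ∉ slopeSublevel A (lam * (((2 : ℝ) ^ k) ^ γ)⁻¹)
  · classical
    have hspec := Nat.find_spec h0
    have hlt : ENNReal.ofReal (lam * (((2 : ℝ) ^ Nat.find h0) ^ γ)⁻¹ * t) < A t := by
      by_contra! hle
      exact hspec ⟨ht, hle⟩
    have hb := bound _ (by positivity) hlt
    rcases hj : Nat.find h0 with _ | j
    · rw [hj] at hb
      refine le_add_right (hb.trans (le_of_eq ?_))
      simp
    · have hmem : t ∈ slopeSublevel A (lam * (((2 : ℝ) ^ j) ^ γ)⁻¹) :=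
        not_not.1 (Nat.find_min h0 (by omega))
      rw [hj] at hb
      refine le_add_left (hb.trans ?_)
      refine le_trans (le_of_eq ?_) (mul_le_mul_right (ENNReal.le_tsum j) _)
      rw [indicator_of_mem hmem, ← ENNReal.ofReal_mul (by positivity)]
      congr 1
      rw [mul_inv, inv_inv, Real.mul_rpow (by positivity) (by positivity),
        ← Real.rpow_mul (by positivity), mul_div_cancel₀ _ hγ.ne', pow_succ,
        Real.mul_rpow (by positivity) (by positivity)]
      ring
  · push Not at h0
    refine le_add_left (le_trans le_top (le_of_eq ?_))
    have htop : ∑' k : ℕ, (slopeSublevel A (lam * (((2 : ℝ) ^ k) ^ γ)⁻¹)).indicator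
          (fun _ => ENNReal.ofReal (((2 : ℝ) ^ k) ^ β)) t = ⊤ := by
      refine top_le_iff.1 ?_
      rw [← ENNReal.tsum_const_eq_top_of_ne_zero (α := ℕ) one_ne_zero]
      refine ENNReal.tsum_le_tsum fun k => ?_
      rw [indicator_of_mem (h0 k), ENNReal.one_le_ofReal]
      exact Real.one_le_rpow (one_le_pow₀ one_le_two) hβ.le
    rw [htop, ENNReal.mul_top]
    simpa using by positivity

theorem intCondK_of_dyadic_duality_bound {n : ℕ} {s : ℝ} (hs1 : 1 < s) (hsn : s < (n : ℝ) + 1)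
    {A : ℝ → ℝ≥0∞} (hA : IsYoung A) {M K : ℝ} (hM : 0 < M) (hK : 0 < K)
    (h : ∀ (N : ℕ) (b : ℕ → ℝ), (∀ k, 0 ≤ b k) →
      ∑ k ∈ Finset.range N, ENNReal.ofReal (((2 : ℝ) ^ k) ^ n) * A (b k) ≤ ENNReal.ofReal K →
      ∑ k ∈ Finset.range N, b k * ((2 : ℝ) ^ k) ^ (s - 1) ≤ M) :
    IntCondK n s 0 A := by
  set β := s - 1 with hβdef
  set γ := (n : ℝ) - β with hγdef
  have hβ : 0 < β := by simp only [hβdef]; linarith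
  have hγ : 0 < γ := by simp only [hγdef, hβdef]; linarith
  set lam : ℝ := K / (2 * M) with hlam
  have hlam0 : 0 < lam := by positivity
  choose b hb0 hbmem hbvol using fun k : ℕ =>
    exists_mem_slopeSublevel_ge A (lam * (((2 : ℝ) ^ k) ^ γ)⁻¹)
  have hbA : ∀ k, A (b k) ≤ ENNReal.ofReal (lam * (((2 : ℝ) ^ k) ^ γ)⁻¹ * b k) := by
    intro k
    rcases hbmem k with h0 | h0
    · rw [h0, hA.1]; exact zero_le
    · exact h0.2
  have hS : ∀ N, ∑ k ∈ Finset.range N, b k * ((2 : ℝ) ^ k) ^ β ≤ 2 * M := by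
    intro N
    by_contra! hgt
    set S := ∑ k ∈ Finset.range N, b k * ((2 : ℝ) ^ k) ^ β with hSdef
    have hS0 : 0 < S := by linarith
    set θ : ℝ := 2 * M / S with hθ
    have hθ0 : 0 ≤ θ := by positivity
    have hθ1 : θ ≤ 1 := (div_le_one hS0).2 hgt.le
    have := h N (fun k => θ * b k) (fun k => mul_nonneg hθ0 (hb0 k)) ?_
    · simp_rw [mul_assoc] at this
      rw [← Finset.mul_sum, ← hSdef, hθ, div_mul_cancel₀ _ hS0.ne'] at this
      linarith
    · calc ∑ k ∈ Finset.range N, ENNReal.ofReal (((2 : ℝ) ^ k) ^ n) * A (θ * b k)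
          ≤ ∑ k ∈ Finset.range N, ENNReal.ofReal (θ * lam * (b k * ((2 : ℝ) ^ k) ^ β)) := by
            refine Finset.sum_le_sum fun k _ => ?_
            have hq : (0 : ℝ) < (2 : ℝ) ^ k := by positivity
            refine (mul_le_mul_right ((hA.scale_le (hb0 k) hθ0 hθ1).trans
              (mul_le_mul_right (hbA k) _)) _).trans (le_of_eq ?_)
            rw [← ENNReal.ofReal_mul hθ0, ← ENNReal.ofReal_mul (by positivity)]
            congr 1
            rw [hγdef, Real.rpow_sub hq, Real.rpow_natCast]
            have : (0 : ℝ) < ((2 : ℝ) ^ k) ^ β := by positivity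
            field_simp
        _ = ENNReal.ofReal (θ * lam * S) := by
            rw [hSdef, Finset.mul_sum, ENNReal.ofReal_sum_of_nonneg]
            intro k _
            have := hb0 k
            positivity
        _ = ENNReal.ofReal K := by
            congr 1
            rw [hθ, hlam]; field_simp
  refine ⟨1, one_pos, ?_⟩
  have hexp : (s - ((0 : ℕ) : ℝ) - 1) / ((n : ℝ) - (s - ((0 : ℕ) : ℝ) - 1)) = β / γ := by
    simp [hγdef, hβdef]
  rw [hexp]
  have hmeas : ∀ k : ℕ, Measurable fun t : ℝ =>
      (slopeSublevel A (lam * (((2 : ℝ) ^ k) ^ γ)⁻¹)).indicator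
        (fun _ => ENNReal.ofReal (((2 : ℝ) ^ k) ^ β)) t := fun k =>
    measurable_const.indicator (hA.measurableSet_slopeSublevel _)
  refine (setLIntegral_mono' measurableSet_Ioc fun t ht =>
    rpow_div_le_dyadic hβ hγ hlam0 ht).trans_lt ?_
  rw [lintegral_add_left measurable_const, lintegral_const_mul _ (Measurable.tsum hmeas),
    lintegral_tsum fun k => (hmeas k).aemeasurable]
  refine ENNReal.add_lt_top.2 ⟨?_, ENNReal.mul_lt_top ENNReal.ofReal_lt_top ?_⟩
  · rw [setLIntegral_const]
    exact ENNReal.mul_lt_top ENNReal.ofReal_lt_top measure_Ioc_lt_top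
  · have hterm : ∀ k : ℕ, ∫⁻ t in Ioc (0 : ℝ) 1,
        (slopeSublevel A (lam * (((2 : ℝ) ^ k) ^ γ)⁻¹)).indicator
          (fun _ => ENNReal.ofReal (((2 : ℝ) ^ k) ^ β)) t ≤
        ENNReal.ofReal (2 * (b k * ((2 : ℝ) ^ k) ^ β)) := by
      intro k
      refine (setLIntegral_le_lintegral _ _).trans ?_
      rw [lintegral_indicator_const (hA.measurableSet_slopeSublevel _)]
      refine (mul_le_mul_right (hbvol k) _).trans (le_of_eq ?_)
      rw [← ENNReal.ofReal_mul (by positivity)]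
      congr 1
      ring
    refine ((ENNReal.tsum_le_tsum hterm).trans ?_).trans_lt
      (ENNReal.ofReal_lt_top (r := 2 * (2 * M)))
    rw [ENNReal.tsum_eq_iSup_nat]
    refine iSup_le fun N => ?_
    rw [← ENNReal.ofReal_sum_of_nonneg fun k _ => by have := hb0 k; positivity, ← Finset.mul_sum]
    exact ENNReal.ofReal_le_ofReal (by linarith [hS N])

/-- Admissible parameters for `k = 0`: if `V^{s,A}_{d,1}(ℝⁿ)` embeds into
some Campanato space `𝓛^φ(ℝⁿ)` with `φ` admissible, then `s < n + 1` and
`∫_0 (t/A(t))^{(s-1)/(n+1-s)} dt < ∞`. -/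
theorem stmt5 (n : ℕ) (hn : 0 < n) (s : ℝ) (hs1 : 1 < s) (hs2 : ∀ m : ℕ, s ≠ (m : ℝ))
    (A : ℝ → ℝ≥0∞) (hA : IsYoung A)
    (h : ∃ (φ : ℝ → ℝ) (c : ℝ), Admissible φ ∧ 0 < c ∧
      ∀ (u : Euc n → ℝ) (D : (h : ℕ) → Euc n → (Fin h → Fin n) → ℝ),
        HasWeakDerivs n ⌊s⌋₊ u D → DecayFrom n 1 ⌊s⌋₊ D →
        fracSem n (s - (⌊s⌋₊ : ℝ)) A (D ⌊s⌋₊) < ⊤ →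
        campSem n φ u ≤ ENNReal.ofReal c * fracSem n (s - (⌊s⌋₊ : ℝ)) A (D ⌊s⌋₊)) :
    s < (n : ℝ) + 1 ∧ IntCondK n s 0 A := by
  obtain ⟨M, K, hM, hK, hdual⟩ := exists_dyadic_duality_bound hn hs1 hs2 hA h
  have hsn := lt_of_dyadic_duality_bound hs2 hA hK hdual
  exact ⟨hsn, intCondK_of_dyadic_duality_bound hs1 hsn hA hM hK hdual⟩
end

section
/- Let n ∈ ℕ, s ∈ (1, n+1)\ℕ and let A be a Young function with ∫_0 (t/A(t))^{(s−1)/(n+1−s)} dt < ∞. Then there exists a constant c = c(n,s) such that |u|_{𝓛^{ψ_{s,A}}(ℝⁿ)} ≤ c |∇^{[s]}u|_{{s},A,ℝⁿ} for every u ∈ V^{s,A}_{d,1}(ℝⁿ); in particular, V^{s,A}_{d,1}(ℝⁿ) is continuously embedded into the Campanato space 𝓛^{ψ_{s,A}}(ℝⁿ). -/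
open MeasureTheory Metric Set Filter
open scoped ENNReal Topology

section Translation

lemma integrable_uncurry_of_lintegral_le {E : Type*} [MeasurableSpace E] {ν : Measure E} [SFinite ν]
    {H : E → ℝ → ℝ}
    (hH : Measurable (Function.uncurry H)) {M : ℝ≥0∞} (hM : M ≠ ⊤)
    (hb : ∀ t ∈ Ioc (0 : ℝ) 1, ∫⁻ x, ‖H x t‖ₑ ∂ν ≤ M) :
    Integrable (Function.uncurry H) (ν.prod (volume.restrict (Ioc (0 : ℝ) 1))) := by
  refine ⟨hH.aestronglyMeasurable, ?_⟩
  rw [hasFiniteIntegral_iff_enorm, lintegral_prod_symm _ hH.enorm.aemeasurable]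
  calc ∫⁻ t in Ioc (0 : ℝ) 1, ∫⁻ x, ‖H x t‖ₑ ∂ν
      ≤ ∫⁻ t in Ioc (0 : ℝ) 1, M := setLIntegral_mono measurable_const hb
    _ = M := by simp
    _ < ⊤ := hM.lt_top

/-- The set swept by `K` when translated by `t • h`, `t ∈ [0,1]`. -/
lemma exists_compact_sweep {E : Type*} [NormedAddCommGroup E] [NormedSpace ℝ E] {K : Set E}
    (hK : IsCompact K) (h : E) :
    ∃ K' : Set E, IsCompact K' ∧ ∀ t ∈ Icc (0 : ℝ) 1, ∀ x ∈ K, x + t • h ∈ K' := by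
  refine ⟨(fun p : E × ℝ => p.1 + p.2 • h) '' (K ×ˢ Icc (0 : ℝ) 1),
    (hK.prod isCompact_Icc).image (by fun_prop), ?_⟩
  intro t ht x hx
  exact ⟨(x, t), ⟨hx, ht⟩, rfl⟩

lemma sub_eq_setIntegral_fderiv {E : Type*} [NormedAddCommGroup E] [NormedSpace ℝ E] {φ : E → ℝ}
    (hφ : ContDiff ℝ (⊤ : ℕ∞) φ) (x h : E) :
    φ (x - h) - φ x = ∫ t in Ioc (0 : ℝ) 1, -(fderiv ℝ φ (x - t • h) h) := by
  have hd : ∀ t : ℝ, HasDerivAt (fun t : ℝ => φ (x - t • h)) (-(fderiv ℝ φ (x - t • h) h)) t := by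
    intro t
    have h1 : HasDerivAt (fun t : ℝ => x - t • h) (-h) t := by
      simpa using ((hasDerivAt_id t).smul_const h).const_sub x
    have h2 := (hφ.differentiable (by simp)).differentiableAt (x := x - t • h) |>.hasFDerivAt
    simpa [Function.comp_def] using h2.comp_hasDerivAt t h1
  have hcont : Continuous fun t : ℝ => -(fderiv ℝ φ (x - t • h) h) := by
    have := hφ.continuous_fderiv (by simp)
    fun_prop
  rw [← intervalIntegral.integral_of_le zero_le_one,
    intervalIntegral.integral_eq_sub_of_hasDerivAt (fun t _ => hd t)
      (hcont.intervalIntegrable _ _)]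
  simp

variable {E : Type*} [NormedAddCommGroup E] [MeasurableSpace E] [BorelSpace E] {μ : Measure E}

lemma setLIntegral_comp_add_le [μ.IsAddRightInvariant] (F : E → ℝ≥0∞) {S T : Set E}
    (hS : MeasurableSet S)
    (hT : MeasurableSet T) (a : E) (h : ∀ x ∈ S, x + a ∈ T) :
    ∫⁻ x in S, F (x + a) ∂μ ≤ ∫⁻ x in T, F x ∂μ := by
  rw [← lintegral_indicator hS, ← lintegral_indicator hT,
    ← lintegral_add_right_eq_self (μ := μ) (T.indicator F) a]
  refine lintegral_mono fun x => ?_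
  by_cases hx : x ∈ S
  · simp [hx, h x hx]
  · simp [hx]

variable [NormedSpace ℝ E] [μ.IsAddHaarMeasure]

lemma exists_lintegral_translate_mul_le {G ψ : E → ℝ} (hG : LocallyIntegrable G μ)
    (hψ : Continuous ψ) (hc : HasCompactSupport ψ) (h : E) :
    ∃ M : ℝ≥0∞, M ≠ ⊤ ∧ ∀ t ∈ Ioc (0 : ℝ) 1, ∫⁻ x, ‖ψ x * G (x + t • h)‖ₑ ∂μ ≤ M := by
  obtain ⟨C, hC⟩ := hψ.bounded_above_of_compact_support hc
  obtain ⟨K', hK', hs⟩ := exists_compact_sweep hc h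
  refine ⟨ENNReal.ofReal C * ∫⁻ x in K', ‖G x‖ₑ ∂μ,
    ENNReal.mul_ne_top ENNReal.ofReal_ne_top (hG.integrableOn_isCompact hK').2.ne, ?_⟩
  intro t ht
  calc ∫⁻ x, ‖ψ x * G (x + t • h)‖ₑ ∂μ
      ≤ ∫⁻ x, ENNReal.ofReal C * (tsupport ψ).indicator (fun x => ‖G (x + t • h)‖ₑ) x ∂μ := by
        refine lintegral_mono fun x => ?_
        by_cases hx : x ∈ tsupport ψ
        · simp only [hx, indicator_of_mem, enorm_mul]
          gcongr
          rw [← ofReal_norm]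
          exact ENNReal.ofReal_le_ofReal (hC x)
        · simp [image_eq_zero_of_notMem_tsupport hx]
    _ = ENNReal.ofReal C * ∫⁻ x in tsupport ψ, ‖G (x + t • h)‖ₑ ∂μ := by
        rw [lintegral_const_mul' _ _ ENNReal.ofReal_ne_top,
          lintegral_indicator hc.measurableSet]
    _ ≤ _ := by
        gcongr ENNReal.ofReal C * ?_
        exact setLIntegral_comp_add_le (μ := μ) (fun x => ‖G x‖ₑ) hc.measurableSet
          hK'.measurableSet _ fun x hx => hs t ⟨ht.1.le, ht.2⟩ x hx

variable [FiniteDimensional ℝ E]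

lemma integrable_translate_restrict {G : E → ℝ} (hG : LocallyIntegrable G μ) (hGm : Measurable G)
    {K : Set E} (hK : IsCompact K) (h : E) :
    Integrable (Function.uncurry fun (x : E) (t : ℝ) => G (x + t • h))
      ((μ.restrict K).prod (volume.restrict (Ioc (0 : ℝ) 1))) := by
  obtain ⟨K', hK', hs⟩ := exists_compact_sweep hK h
  refine integrable_uncurry_of_lintegral_le
    (hGm.comp (by fun_prop : Measurable fun p : E × ℝ => p.1 + p.2 • h))
    (M := ∫⁻ x in K', ‖G x‖ₑ ∂μ) (hG.integrableOn_isCompact hK').2.ne ?_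
  intro t ht
  exact setLIntegral_comp_add_le (fun x => ‖G x‖ₑ) hK.measurableSet hK'.measurableSet _
    fun x hx => hs t ⟨ht.1.le, ht.2⟩ x hx

lemma integrable_translate_mul {G ψ : E → ℝ} (hG : LocallyIntegrable G μ) (hGm : Measurable G)
    (hψ : Continuous ψ) (hc : HasCompactSupport ψ) (h : E) :
    Integrable (Function.uncurry fun (x : E) (t : ℝ) => ψ x * G (x + t • h))
      (μ.prod (volume.restrict (Ioc (0 : ℝ) 1))) := by
  obtain ⟨M, hM, hb⟩ := exists_lintegral_translate_mul_le hG hψ hc h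
  exact integrable_uncurry_of_lintegral_le ((hψ.measurable.comp measurable_fst).mul
      (hGm.comp (by fun_prop : Measurable fun p : E × ℝ => p.1 + p.2 • h))) hM hb

/-- A function with weak directional derivative `G` along `h` is recovered by integrating `G`
along segments in the direction `h`. -/
lemma ae_translate_sub_eq {f G : E → ℝ} (hf : LocallyIntegrable f μ) (hfm : Measurable f)
    (hG : LocallyIntegrable G μ) (hGm : Measurable G) (h : E)
    (hw : ∀ φ : E → ℝ, ContDiff ℝ (⊤ : ℕ∞) φ → HasCompactSupport φ →
      ∫ x, f x * fderiv ℝ φ x h ∂μ = -∫ x, G x * φ x ∂μ) :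
    ∀ᵐ x ∂μ, f (x + h) - f x = ∫ t in Ioc (0 : ℝ) 1, G (x + t • h) := by
  have hft : LocallyIntegrable (fun x => f (x + h)) μ := by
    rw [locallyIntegrable_iff]
    intro K hK
    have hK' : IsCompact ((fun x => x + h) '' K) := hK.image (by fun_prop)
    refine ⟨(hfm.comp (measurable_add_const h)).aestronglyMeasurable, ?_⟩
    rw [hasFiniteIntegral_iff_enorm]
    exact (setLIntegral_comp_add_le (fun x => ‖f x‖ₑ) hK.measurableSet hK'.measurableSet h
      fun x hx => ⟨x, hx, rfl⟩).trans_lt (hf.integrableOn_isCompact hK').2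
  refine ae_eq_of_integral_contDiff_smul_eq (hft.sub hf) ?_ ?_
  · rw [locallyIntegrable_iff]
    intro K hK
    exact (integrable_translate_restrict hG hGm hK h).integral_prod_left
  intro φ hφ hc
  simp only [smul_eq_mul]
  have hφc := hφ.continuous
  have hmul : ∀ {F : E → ℝ}, LocallyIntegrable F μ → ∀ {ψ : E → ℝ}, Continuous ψ →
      HasCompactSupport ψ → Integrable (fun x => ψ x * F x) μ := fun hF ψ h1 h2 =>
    hF.integrable_smul_left_of_hasCompactSupport h1 h2
  have hct : ∀ a : E, HasCompactSupport fun x => φ (x - a) := fun a => by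
    simpa [sub_eq_add_neg, Function.comp_def] using hc.comp_homeomorph (Homeomorph.addRight (-a))
  have hd : HasCompactSupport fun x => fderiv ℝ φ x h := hc.fderiv_apply ℝ h
  have hdc : Continuous fun x => fderiv ℝ φ x h := (hφ.continuous_fderiv (by simp)).clm_apply
    continuous_const
  calc ∫ x, φ x * (f (x + h) - f x) ∂μ
      = ∫ x, φ x * f (x + h) ∂μ - ∫ x, φ x * f x ∂μ := by
        rw [← integral_sub (hmul hft hφc hc) (hmul hf hφc hc)]
        simp only [mul_sub]
    _ = ∫ x, φ (x - h) * f x ∂μ - ∫ x, φ x * f x ∂μ := by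
        rw [← integral_sub_right_eq_self (fun x => φ x * f (x + h)) h]
        simp
    _ = ∫ x, (∫ t in Ioc (0 : ℝ) 1, -(fderiv ℝ φ (x - t • h) h) * f x) ∂μ := by
        rw [← integral_sub (hmul hf (by fun_prop) (hct h)) (hmul hf hφc hc)]
        refine integral_congr_ae (.of_forall fun x => ?_)
        simp only
        rw [integral_mul_const, ← sub_eq_setIntegral_fderiv hφ, sub_mul]
    _ = ∫ t in Ioc (0 : ℝ) 1, ∫ x, -(fderiv ℝ φ (x - t • h) h) * f x ∂μ := by
        refine integral_integral_swap (f := fun x t => -(fderiv ℝ φ (x - t • h) h) * f x) ?_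
        obtain ⟨M, hM, hb⟩ := exists_lintegral_translate_mul_le hf hdc hd h
        refine integrable_uncurry_of_lintegral_le ?_ hM fun t ht => ?_
        · exact (hdc.measurable.comp
            (by fun_prop : Measurable fun p : E × ℝ => p.1 - p.2 • h)).neg.mul
            (hfm.comp measurable_fst)
        · refine le_of_eq_of_le ?_ (hb t ht)
          rw [← lintegral_sub_right_eq_self (fun x => ‖fderiv ℝ φ x h * f (x + t • h)‖ₑ) (t • h)]
          simp
    _ = ∫ t in Ioc (0 : ℝ) 1, ∫ x, φ (x - t • h) * G x ∂μ := by
        refine integral_congr_ae (.of_forall fun t => ?_)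
        have := hw (fun x => φ (x - t • h)) (hφ.comp (contDiff_id.sub contDiff_const)) (hct _)
        simp only [fderiv_comp_sub] at this
        simp only [neg_mul, integral_neg]
        rw [integral_congr_ae (.of_forall fun x => mul_comm _ _), this, neg_neg]
        exact integral_congr_ae (.of_forall fun x => mul_comm _ _)
    _ = ∫ t in Ioc (0 : ℝ) 1, ∫ x, φ x * G (x + t • h) ∂μ := by
        refine integral_congr_ae (.of_forall fun t => ?_)
        simp only
        rw [← integral_sub_right_eq_self (fun x => φ x * G (x + t • h)) (t • h)]
        simp
    _ = ∫ x, (∫ t in Ioc (0 : ℝ) 1, φ x * G (x + t • h)) ∂μ :=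
        (integral_integral_swap (integrable_translate_mul hG hGm hφc hc h)).symm
    _ = ∫ x, φ x * (∫ t in Ioc (0 : ℝ) 1, G (x + t • h)) ∂μ := by
        simp only [integral_const_mul]

end Translation

section Poincare

variable {n : ℕ}

lemma volume_ball_mul (x y : Euc n) {a : ℝ} (ha : 0 < a) (r : ℝ) :
    volume (ball x (a * r)) = ENNReal.ofReal (a ^ n) * volume (ball y r) := by
  rw [Measure.addHaar_ball_mul_of_pos _ _ ha, finrank_euclideanSpace_fin,
    Measure.addHaar_ball_center _ y]

lemma volume_ball_two_pow (x : Euc n) (r : ℝ) (k : ℕ) :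
    volume (ball x (2 ^ k * r)) = 2 ^ (n * k) * volume (ball x r) := by
  rw [volume_ball_mul x x (by positivity), ← pow_mul, mul_comm k n,
    ENNReal.ofReal_pow (by norm_num), ENNReal.ofReal_ofNat]

lemma fderiv_apply_eq_sum (φ : Euc n → ℝ) (x h : Euc n) :
    fderiv ℝ φ x h = ∑ i, h i * fderiv ℝ φ x (EuclideanSpace.single i (1 : ℝ)) := by
  conv_lhs => rw [← (EuclideanSpace.basisFun (Fin n) ℝ).sum_repr h]
  simp [map_sum]

/-- `f` has weak partial derivatives `g i`. -/
def HasWeakGrad (f : Euc n → ℝ) (g : Fin n → Euc n → ℝ) : Prop :=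
  ∀ i, ∀ φ : Euc n → ℝ, ContDiff ℝ (⊤ : ℕ∞) φ → HasCompactSupport φ →
    ∫ x, f x * fderiv ℝ φ x (EuclideanSpace.single i (1 : ℝ)) = -∫ x, g i x * φ x

lemma HasWeakGrad.directional {f : Euc n → ℝ} {g : Fin n → Euc n → ℝ} (hw : HasWeakGrad f g)
    (hf : LocallyIntegrable f) (hg : ∀ i, LocallyIntegrable (g i)) (h : Euc n) {φ : Euc n → ℝ}
    (hφ : ContDiff ℝ (⊤ : ℕ∞) φ) (hc : HasCompactSupport φ) :
    ∫ x, f x * fderiv ℝ φ x h = -∫ x, (∑ i, h i * g i x) * φ x := by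
  simp only [fderiv_apply_eq_sum φ _ h, Finset.mul_sum, Finset.sum_mul]
  rw [integral_finsetSum, integral_finsetSum, ← Finset.sum_neg_distrib]
  · refine Finset.sum_congr rfl fun i _ => ?_
    simp only [mul_left_comm (f _) (h i), mul_assoc]
    rw [integral_const_mul, integral_const_mul, hw i φ hφ hc, mul_neg]
  · intro i _
    simp only [mul_assoc]
    exact ((hg i).integrable_smul_right_of_hasCompactSupport hφ.continuous hc).const_mul _
  · intro i _
    simp only [mul_left_comm (f _) (h i)]
    exact (hf.integrable_smul_right_of_hasCompactSupport
      ((hφ.continuous_fderiv (by simp)).clm_apply continuous_const)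
      (hc.fderiv_apply ℝ _)).const_mul _

lemma lintegral_translate_sub_le {f : Euc n → ℝ} {g : Fin n → Euc n → ℝ} (hw : HasWeakGrad f g)
    (hf : LocallyIntegrable f) (hg : ∀ i, LocallyIntegrable (g i))
    (hfm : Measurable f) (hgm : ∀ i, Measurable (g i)) (x₀ : Euc n) (r : ℝ) (h : Euc n) :
    ∫⁻ x in ball x₀ r, (ball x₀ r).indicator (fun y => ‖f x - f y‖ₑ) (x + h) ≤
      ‖h‖ₑ * ∑ i, ∫⁻ x in ball x₀ r, ‖g i x‖ₑ := by
  set B := ball x₀ r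
  have hB : MeasurableSet B := measurableSet_ball
  set G : Euc n → ℝ := fun x => ∑ i, h i * g i x with hGdef
  have hG : LocallyIntegrable G := locallyIntegrable_finsetSum _ fun i _ => (hg i).smul (h i)
  have hGm : Measurable G := by fun_prop
  have hae := ae_translate_sub_eq hf hfm hG hGm h fun φ => hw.directional hf hg h
  set U : Set (Euc n) := B ∩ (fun x => x + h) ⁻¹' B
  have hU : MeasurableSet U := hB.inter (hB.preimage (measurable_add_const h))
  calc ∫⁻ x in B, B.indicator (fun y => ‖f x - f y‖ₑ) (x + h)
      = ∫⁻ x in U, ‖f (x + h) - f x‖ₑ := by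
        rw [← lintegral_indicator hB, ← lintegral_indicator hU]
        refine lintegral_congr fun x => ?_
        by_cases h1 : x ∈ B <;> by_cases h2 : x + h ∈ B <;>
          simp [U, h1, h2, enorm_sub_rev]
    _ = ∫⁻ x in U, ‖∫ t in Ioc (0 : ℝ) 1, G (x + t • h)‖ₑ :=
        lintegral_congr_ae (ae_restrict_of_ae (hae.mono fun x hx => by simp only [hx]))
    _ ≤ ∫⁻ x in U, ∫⁻ t in Ioc (0 : ℝ) 1, ‖G (x + t • h)‖ₑ :=
        lintegral_mono fun x => enorm_integral_le_lintegral_enorm _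
    _ = ∫⁻ t in Ioc (0 : ℝ) 1, ∫⁻ x in U, ‖G (x + t • h)‖ₑ := by
        refine lintegral_lintegral_swap (Measurable.aemeasurable ?_)
        exact (hGm.comp (by fun_prop : Measurable fun p : Euc n × ℝ => p.1 + p.2 • h)).enorm
    _ ≤ ∫⁻ t in Ioc (0 : ℝ) 1, ∫⁻ x in B, ‖G x‖ₑ := by
        refine setLIntegral_mono measurable_const fun t ht => ?_
        refine setLIntegral_comp_add_le (fun x => ‖G x‖ₑ) hU hB _ fun x hx => ?_
        have := (convex_ball x₀ r).add_smul_sub_mem hx.1 hx.2 (Ioc_subset_Icc_self ht)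
        simpa only [add_sub_cancel_left] using this
    _ = ∫⁻ x in B, ‖G x‖ₑ := by simp
    _ ≤ ∫⁻ x in B, ‖h‖ₑ * ∑ i, ‖g i x‖ₑ := by
        refine lintegral_mono fun x => (enorm_sum_le _ _).trans ?_
        rw [Finset.mul_sum]
        gcongr with i
        rw [enorm_mul]
        gcongr
        rw [enorm_le_iff_norm_le]
        exact PiLp.norm_apply_le h i
    _ = _ := by
        rw [lintegral_const_mul' _ _ enorm_ne_top,
          lintegral_finsetSum _ fun i _ => (hgm i).enorm]

lemma lintegral_ball_sub_le_of_measurable {f : Euc n → ℝ} {g : Fin n → Euc n → ℝ}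
    (hw : HasWeakGrad f g) (hf : LocallyIntegrable f) (hg : ∀ i, LocallyIntegrable (g i))
    (hfm : Measurable f) (hgm : ∀ i, Measurable (g i)) (x₀ : Euc n) (r : ℝ) :
    ∫⁻ x in ball x₀ r, ∫⁻ y in ball x₀ r, ‖f x - f y‖ₑ ≤
      ENNReal.ofReal (2 * r) * volume (ball (0 : Euc n) (2 * r)) *
        ∑ i, ∫⁻ x in ball x₀ r, ‖g i x‖ₑ := by
  set S := ∑ i, ∫⁻ x in ball x₀ r, ‖g i x‖ₑ
  calc ∫⁻ x in ball x₀ r, ∫⁻ y in ball x₀ r, ‖f x - f y‖ₑ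
      = ∫⁻ x in ball x₀ r, ∫⁻ h, (ball x₀ r).indicator (fun y => ‖f x - f y‖ₑ) (x + h) := by
        refine lintegral_congr fun x => ?_
        rw [lintegral_add_left_eq_self (fun z => (ball x₀ r).indicator (fun y => ‖f x - f y‖ₑ) z),
          lintegral_indicator measurableSet_ball]
    _ = ∫⁻ h, ∫⁻ x in ball x₀ r, (ball x₀ r).indicator (fun y => ‖f x - f y‖ₑ) (x + h) := by
        refine lintegral_lintegral_swap (Measurable.aemeasurable ?_)
        have h1 : Measurable fun p : Euc n × Euc n => ‖f p.1 - f (p.1 + p.2)‖ₑ := by fun_prop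
        have h2 : MeasurableSet ((fun p : Euc n × Euc n => p.1 + p.2) ⁻¹' ball x₀ r) :=
          measurableSet_ball.preimage (by fun_prop)
        exact h1.indicator h2
    _ ≤ ∫⁻ h, (ball (0 : Euc n) (2 * r)).indicator (fun _ => ENNReal.ofReal (2 * r) * S) h := by
        refine lintegral_mono fun h => ?_
        by_cases hh : h ∈ ball (0 : Euc n) (2 * r)
        · simp only [hh, indicator_of_mem]
          refine (lintegral_translate_sub_le hw hf hg hfm hgm x₀ r h).trans ?_
          gcongr
          rw [← ofReal_norm]
          exact ENNReal.ofReal_le_ofReal (by simpa using (mem_ball_zero_iff.1 hh).le)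
        · refine le_of_eq_of_le (setLIntegral_congr_fun measurableSet_ball fun x hx => ?_)
            (by simp : ∫⁻ x in ball x₀ r, (0 : ℝ≥0∞) ≤ _)
          refine indicator_of_notMem (fun hy => hh ?_) _
          rw [mem_ball_zero_iff]
          have := dist_triangle_right (x + h) x x₀
          rw [mem_ball] at hx hy
          rw [dist_eq_norm, add_sub_cancel_left] at this
          linarith
    _ = _ := by
        rw [lintegral_indicator measurableSet_ball, setLIntegral_const]
        ring

/-- The `L¹` Poincaré inequality on balls, in double-integral form. -/
lemma lintegral_ball_sub_le {f : Euc n → ℝ} {g : Fin n → Euc n → ℝ}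
    (hw : HasWeakGrad f g) (hf : LocallyIntegrable f) (hg : ∀ i, LocallyIntegrable (g i))
    (x₀ : Euc n) (r : ℝ) :
    ∫⁻ x in ball x₀ r, ∫⁻ y in ball x₀ r, ‖f x - f y‖ₑ ≤
      ENNReal.ofReal (2 * r) * volume (ball (0 : Euc n) (2 * r)) *
        ∑ i, ∫⁻ x in ball x₀ r, ‖g i x‖ₑ := by
  have hfm := hf.aestronglyMeasurable
  have hgm := fun i => (hg i).aestronglyMeasurable
  have hfe := hfm.ae_eq_mk
  have hge := fun i => (hgm i).ae_eq_mk
  have key := lintegral_ball_sub_le_of_measurable (f := hfm.mk f) (g := fun i => (hgm i).mk (g i))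
    ?_ (hf.congr hfe) (fun i => (hg i).congr (hge i))
    hfm.stronglyMeasurable_mk.measurable (fun i => (hgm i).stronglyMeasurable_mk.measurable) x₀ r
  · convert key using 1
    · refine lintegral_congr_ae (ae_restrict_of_ae (hfe.mono fun x hx => ?_))
      simp only [← hx]
      refine lintegral_congr_ae (ae_restrict_of_ae (hfe.mono fun y hy => ?_))
      simp only [← hy]
    · congr 1
      refine Finset.sum_congr rfl fun i _ => ?_
      refine lintegral_congr_ae (ae_restrict_of_ae ((hge i).mono fun y hy => ?_))
      simp only [← hy]
  · intro i φ hφ hc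
    rw [integral_congr_ae (hfe.symm.mono fun x hx => by simp only [hx] :
        (fun x => hfm.mk f x * fderiv ℝ φ x (EuclideanSpace.single i (1 : ℝ))) =ᵐ[volume]
        fun x => f x * fderiv ℝ φ x (EuclideanSpace.single i (1 : ℝ))),
      integral_congr_ae ((hge i).symm.mono fun x hx => by simp only [hx] :
        (fun x => (hgm i).mk (g i) x * φ x) =ᵐ[volume] fun x => g i x * φ x)]
    exact hw i φ hφ hc

end Poincare

section Averages

lemma setLAverage_le_mul_of_subset {α : Type*} [MeasurableSpace α] {μ : Measure α} {S T : Set α}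
    {K : ℝ≥0∞} (hST : S ⊆ T) (hK : K ≠ 0) (hK' : K ≠ ⊤) (h : μ T ≤ K * μ S) (F : α → ℝ≥0∞) :
    ⨍⁻ x in S, F x ∂μ ≤ K * ⨍⁻ x in T, F x ∂μ := by
  rw [setLAverage_eq, setLAverage_eq, ENNReal.div_eq_inv_mul, ENNReal.div_eq_inv_mul, ← mul_assoc]
  refine mul_le_mul' ?_ (lintegral_mono_set hST)
  rw [ENNReal.inv_le_iff_inv_le, ENNReal.mul_inv (.inl hK) (.inl hK'), inv_inv,
    ← ENNReal.div_eq_inv_mul]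
  exact ENNReal.div_le_of_le_mul' h

lemma setLAverage_enorm_le {α : Type*} [MeasurableSpace α] {μ : Measure α} {S T : Set α}
    {f : α → ℝ} (hf : AEMeasurable f (μ.restrict T)) (hS : μ S ≠ 0) (hS' : μ S ≠ ⊤)
    (hT : μ T ≠ 0) (hT' : μ T ≠ ⊤) :
    ⨍⁻ x in S, ‖f x‖ₑ ∂μ ≤
      ⨍⁻ x in S, ⨍⁻ y in T, ‖f x - f y‖ₑ ∂μ ∂μ + ⨍⁻ y in T, ‖f y‖ₑ ∂μ := by
  have key : ∀ x, ‖f x‖ₑ ≤ ⨍⁻ y in T, ‖f x - f y‖ₑ ∂μ + ⨍⁻ y in T, ‖f y‖ₑ ∂μ := by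
    intro x
    calc ‖f x‖ₑ = ⨍⁻ y in T, ‖f x‖ₑ ∂μ := (setLAverage_const hT hT' _).symm
      _ ≤ ⨍⁻ y in T, (‖f x - f y‖ₑ + ‖f y‖ₑ) ∂μ := by
        refine laverage_mono_ae (.of_forall fun y => ?_)
        simpa using enorm_add_le (f x - f y) (f y)
      _ = _ := by
        simp only [setLAverage_eq]
        rw [lintegral_add_right' _ hf.enorm, ENNReal.add_div]
  calc ⨍⁻ x in S, ‖f x‖ₑ ∂μ
      ≤ ⨍⁻ x in S, (⨍⁻ y in T, ‖f x - f y‖ₑ ∂μ + ⨍⁻ y in T, ‖f y‖ₑ ∂μ) ∂μ :=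
        laverage_mono_ae (.of_forall key)
    _ = ⨍⁻ x in S, ⨍⁻ y in T, ‖f x - f y‖ₑ ∂μ ∂μ + ⨍⁻ x in S, ⨍⁻ y in T, ‖f y‖ₑ ∂μ ∂μ := by
        simp only [setLAverage_eq]
        rw [lintegral_add_right _ measurable_const, ENNReal.add_div]
    _ = _ := by rw [setLAverage_const hS hS']

variable {n : ℕ}

lemma setLAverage_ball_sub_le {f : Euc n → ℝ} {g : Fin n → Euc n → ℝ}
    (hw : HasWeakGrad f g) (hf : LocallyIntegrable f) (hg : ∀ i, LocallyIntegrable (g i))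
    (x₀ : Euc n) {r : ℝ} (hr : 0 < r) :
    ⨍⁻ x in ball x₀ r, ⨍⁻ y in ball x₀ r, ‖f x - f y‖ₑ ∂volume ∂volume ≤
      2 ^ (n + 1) * ENNReal.ofReal r * ∑ i, ⨍⁻ x in ball x₀ r, ‖g i x‖ₑ ∂volume := by
  set V := volume (ball x₀ r) with hV
  have hV0 : V ≠ 0 := (measure_ball_pos _ _ hr).ne'
  have hV1 : V ≠ ⊤ := measure_ball_lt_top.ne
  have h2 : volume (ball (0 : Euc n) (2 * r)) = 2 ^ n * V := by
    rw [volume_ball_mul 0 x₀ two_pos, ENNReal.ofReal_pow (by norm_num), ENNReal.ofReal_ofNat]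
  simp only [setLAverage_eq, ← hV]
  simp only [ENNReal.div_eq_inv_mul]
  rw [lintegral_const_mul' _ _ (ENNReal.inv_ne_top.2 hV0), ← Finset.mul_sum]
  calc V⁻¹ * (V⁻¹ * ∫⁻ x in ball x₀ r, ∫⁻ y in ball x₀ r, ‖f x - f y‖ₑ)
      ≤ V⁻¹ * (V⁻¹ * (ENNReal.ofReal (2 * r) * (2 ^ n * V) *
          ∑ i, ∫⁻ x in ball x₀ r, ‖g i x‖ₑ)) := by
        rw [← h2]
        gcongr
        exact lintegral_ball_sub_le hw hf hg x₀ r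
    _ = (V⁻¹ * V) * (2 ^ (n + 1) * ENNReal.ofReal r * (V⁻¹ *
          ∑ i, ∫⁻ x in ball x₀ r, ‖g i x‖ₑ)) := by
        rw [ENNReal.ofReal_mul two_pos.le, ENNReal.ofReal_ofNat]
        ring
    _ = _ := by rw [ENNReal.inv_mul_cancel hV0 hV1, one_mul]

/-- Averages over a ball of a function vanishing at infinity, in measure, are controlled by its
oscillations over the dyadic dilations of the ball. -/
lemma setLAverage_ball_le_tsum (hn : 0 < n) {f : Euc n → ℝ} (hf : LocallyIntegrable f)
    (hdec : ∀ t : ℝ, 0 < t → volume {x | t < |f x|} < ⊤) (x₀ : Euc n) {r : ℝ} (hr : 0 < r)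
    (k : ℕ) :
    ⨍⁻ x in ball x₀ (2 ^ k * r), ‖f x‖ₑ ∂volume ≤ (2 ^ n + 2) * ∑' j, (Ici k).indicator
      (fun j => ⨍⁻ x in ball x₀ (2 ^ j * r), ⨍⁻ y in ball x₀ (2 ^ j * r), ‖f x - f y‖ₑ
        ∂volume ∂volume) j := by
  set B : ℕ → Set (Euc n) := fun j => ball x₀ (2 ^ j * r) with hBdef
  set O : ℕ → ℝ≥0∞ := fun j => ⨍⁻ x in B j, ⨍⁻ y in B j, ‖f x - f y‖ₑ ∂volume ∂volume with hO
  have hB0 : ∀ j, volume (B j) ≠ 0 := fun j => (measure_ball_pos _ _ (by positivity)).ne'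
  have hB1 : ∀ j, volume (B j) ≠ ⊤ := fun j => measure_ball_lt_top.ne
  have hfm : AEMeasurable f := hf.aestronglyMeasurable.aemeasurable
  have hstep : ∀ j, ⨍⁻ x in B j, ‖f x‖ₑ ∂volume ≤
      2 ^ n * O (j + 1) + ⨍⁻ x in B (j + 1), ‖f x‖ₑ ∂volume := by
    intro j
    refine (setLAverage_enorm_le hfm.restrict (hB0 j) (hB1 j) (hB0 (j + 1)) (hB1 (j + 1))).trans ?_
    gcongr
    refine setLAverage_le_mul_of_subset (ball_subset_ball ?_) (by positivity) (by simp) ?_ _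
    · rw [pow_succ]
      nlinarith [pow_pos (two_pos (α := ℝ)) j]
    · rw [volume_ball_two_pow, volume_ball_two_pow]
      exact le_of_eq (by ring)
  have hchain : ∀ N, k ≤ N → ⨍⁻ x in B k, ‖f x‖ₑ ∂volume ≤
      2 ^ n * ∑ j ∈ Finset.Ioc k N, O j + ⨍⁻ x in B N, ‖f x‖ₑ ∂volume := by
    intro N hN
    induction N, hN using Nat.le_induction with
    | base => simp
    | succ N hN ih =>
      rw [← Finset.insert_Ioc_right_eq_Ioc_add_one (by omega), Finset.sum_insert (by simp)]
      refine ih.trans ((add_le_add_right (hstep N) _).trans (le_of_eq ?_))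
      ring
  set T := ∑' j, (Ici k).indicator O j
  have hT : ∀ N, ∑ j ∈ Finset.Ioc k N, O j ≤ T := by
    intro N
    refine le_trans (le_of_eq (Finset.sum_congr rfl fun j hj => ?_))
      (ENNReal.sum_le_tsum (Finset.Ioc k N))
    rw [indicator_of_mem (by simpa using (Finset.mem_Ioc.1 hj).1.le)]
  have hTO : ∀ N, k ≤ N → O N ≤ T := by
    intro N hN
    refine le_trans (le_of_eq ?_) (ENNReal.le_tsum N)
    rw [indicator_of_mem (by simpa using hN)]
  refine ENNReal.le_of_forall_pos_le_add fun t ht _ => ?_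
  set S := toMeasurable volume {x | (t : ℝ) < |f x|}
  have hS : volume S < ⊤ := by rw [measure_toMeasurable]; exact hdec t ht
  obtain ⟨N, hkN, hN⟩ : ∃ N, k ≤ N ∧ 2 * volume S ≤ volume (B N) := by
    obtain ⟨M, hM⟩ := ENNReal.exists_nat_mul_gt (measure_ball_pos volume x₀ hr).ne'
      (ENNReal.mul_ne_top ENNReal.ofNat_ne_top hS.ne : 2 * volume S ≠ ⊤)
    refine ⟨max k M, le_max_left _ _, hM.le.trans ?_⟩
    rw [hBdef, volume_ball_two_pow]
    gcongr
    have : M ≤ 2 ^ (n * max k M) := by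
      calc M ≤ 2 ^ M := Nat.lt_two_pow_self.le
        _ ≤ _ := Nat.pow_le_pow_right (by norm_num)
          ((le_max_right k M).trans (Nat.le_mul_of_pos_left _ hn))
    exact_mod_cast this
  have hG : volume (B N) ≤ 2 * volume (B N \ S) := by
    have h1 : volume (B N) ≤ volume (B N \ S) + volume S :=
      (measure_mono (by intro x hx; by_cases h : x ∈ S <;> simp [h, hx])).trans
        (measure_union_le _ _)
    have h2 : volume (B N) + 2 * volume S ≤ 2 * volume (B N \ S) + 2 * volume S := by
      rw [← mul_add]
      calc volume (B N) + 2 * volume S ≤ volume (B N) + volume (B N) := by gcongr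
        _ = 2 * volume (B N) := (two_mul _).symm
        _ ≤ _ := by gcongr
    exact (ENNReal.add_le_add_iff_right (ENNReal.mul_ne_top ENNReal.ofNat_ne_top hS.ne)).1 h2
  have hG0 : volume (B N \ S) ≠ 0 := fun h => hB0 N (by simpa [h] using hG)
  have hG1 : volume (B N \ S) ≠ ⊤ := measure_ne_top_of_subset sdiff_subset (hB1 N)
  have htail : ⨍⁻ x in B N, ‖f x‖ₑ ∂volume ≤ 2 * O N + t := by
    refine (setLAverage_enorm_le (T := B N \ S) hfm.restrict (hB0 N) (hB1 N) hG0 hG1).trans ?_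
    gcongr
    · calc ⨍⁻ x in B N, ⨍⁻ y in B N \ S, ‖f x - f y‖ₑ ∂volume ∂volume
          ≤ ⨍⁻ x in B N, 2 * ⨍⁻ y in B N, ‖f x - f y‖ₑ ∂volume ∂volume :=
            laverage_mono_ae (.of_forall fun x =>
              setLAverage_le_mul_of_subset sdiff_subset two_ne_zero ENNReal.ofNat_ne_top hG _)
        _ = _ := by
          rw [hO]
          simp only [setLAverage_eq (s := B N)
            (f := fun x => 2 * ⨍⁻ y in B N, ‖f x - f y‖ₑ ∂volume)]
          rw [lintegral_const_mul' _ _ ENNReal.ofNat_ne_top, mul_div_assoc, ← setLAverage_eq]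
    · rw [← setLAverage_const hG0 hG1 (t : ℝ≥0∞)]
      refine laverage_mono_ae ?_
      refine ae_restrict_of_forall_mem
        (measurableSet_ball.diff (measurableSet_toMeasurable _ _)) fun x hx => ?_
      have : ¬ (t : ℝ) < |f x| := fun h => hx.2 (subset_toMeasurable _ _ h)
      rw [enorm_le_coe, ← NNReal.coe_le_coe]
      simpa using this
  calc ⨍⁻ x in B k, ‖f x‖ₑ ∂volume ≤ 2 ^ n * ∑ j ∈ Finset.Ioc k N, O j + (2 * O N + t) :=
        (hchain N hkN).trans (add_le_add_right htail _)
    _ ≤ 2 ^ n * T + (2 * T + t) := by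
        gcongr
        · exact hT N
        · exact hTO N hkN
    _ = (2 ^ n + 2) * T + t := by ring

end Averages

section Chain

lemma tsum_indicator_Ici_dyadic_le (r : ℝ≥0∞) (b : ℕ → ℝ≥0∞) (k : ℕ) :
    ∑' j, (Ici k).indicator (fun j => 2 ^ j * r * ∑' i, (Ici j).indicator b i) j ≤
      2 * ∑' i, (Ici k).indicator (fun i => 2 ^ i * r * b i) i := by
  have hswap : ∑' j, (Ici k).indicator (fun j => 2 ^ j * r * ∑' i, (Ici j).indicator b i) j =
      ∑' i, ∑' j, (if k ≤ j ∧ j ≤ i then 2 ^ j * r * b i else 0) := by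
    rw [ENNReal.tsum_comm]
    refine tsum_congr fun j => ?_
    by_cases hj : k ≤ j
    · simp only [indicator_of_mem (mem_Ici.2 hj), ← ENNReal.tsum_mul_left]
      refine tsum_congr fun i => ?_
      by_cases hi : j ≤ i <;> simp [hi, hj]
    · simp [hj]
  rw [hswap, ← ENNReal.tsum_mul_left]
  refine ENNReal.tsum_le_tsum fun i => ?_
  by_cases hi : k ≤ i
  · rw [indicator_of_mem (mem_Ici.2 hi), tsum_eq_sum (s := Finset.range (i + 1))]
    · calc ∑ j ∈ Finset.range (i + 1), (if k ≤ j ∧ j ≤ i then 2 ^ j * r * b i else 0)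
          ≤ ∑ j ∈ Finset.range (i + 1), (2 : ℝ≥0∞) ^ j * (r * b i) := by
            refine Finset.sum_le_sum fun j _ => ?_
            split_ifs
            · rw [mul_assoc]
            · exact zero_le
        _ = (∑ j ∈ Finset.range (i + 1), (2 : ℝ≥0∞) ^ j) * (r * b i) := by
            rw [Finset.sum_mul]
        _ ≤ 2 ^ (i + 1) * (r * b i) := by
            gcongr
            have : ∑ j ∈ Finset.range (i + 1), 2 ^ j ≤ 2 ^ (i + 1) :=
              (Nat.geomSum_lt (le_refl 2) (by simp)).le
            exact_mod_cast this
        _ = _ := by ring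
    · intro j hj
      rw [if_neg]
      simp only [Finset.mem_range] at hj
      omega
  · rw [indicator_of_notMem (by simpa using hi), mul_zero]
    refine le_of_eq (ENNReal.tsum_eq_zero.2 fun j => if_neg ?_)
    omega

lemma tsum_indicator_const_mul (c : ℝ≥0∞) (b : ℕ → ℝ≥0∞) (s : Set ℕ) :
    ∑' j, s.indicator (fun j => c * b j) j = c * ∑' j, s.indicator b j := by
  rw [← ENNReal.tsum_mul_left]
  exact tsum_congr fun j => by by_cases h : j ∈ s <;> simp [h]

/-- Iteration of the estimates "averages are controlled by oscillations on larger scales" and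
"oscillations are controlled by averages of the next derivative". -/
lemma averages_le_tsum_top {m : ℕ} {r C C' : ℝ≥0∞} {E O : ℕ → ℕ → ℝ≥0∞}
    (hE : ∀ h, 1 ≤ h → h ≤ m → ∀ k, E h k ≤ C * ∑' j, (Ici k).indicator (O h) j)
    (hO : ∀ h < m, ∀ j, O h j ≤ C' * (2 ^ j * r) * E (h + 1) j) (d : ℕ) :
    ∀ h, 1 ≤ h → h + d = m → ∀ k, E h k ≤ (2 * C * C') ^ d * C *
      ∑' j, (Ici k).indicator (fun j => (2 ^ j * r) ^ d * O m j) j := by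
  induction d with
  | zero =>
    intro h h1 hm k
    obtain rfl : h = m := by omega
    simpa using hE h h1 le_rfl k
  | succ d ih =>
    intro h h1 hm k
    calc E h k ≤ C * ∑' j, (Ici k).indicator (O h) j := hE h h1 (by omega) k
      _ ≤ C * ∑' j, (Ici k).indicator (fun j => (C' * ((2 * C * C') ^ d * C)) * (2 ^ j * r *
            ∑' i, (Ici j).indicator (fun i => (2 ^ i * r) ^ d * O m i) i)) j := by
          gcongr with j
          refine (hO h (by omega) j).trans ?_
          refine (mul_le_mul_right (ih (h + 1) (by omega) (by omega) j) _).trans (le_of_eq ?_)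
          ring
      _ ≤ C * ((C' * ((2 * C * C') ^ d * C)) *
            (2 * ∑' i, (Ici k).indicator (fun i => 2 ^ i * r * ((2 ^ i * r) ^ d * O m i)) i)) := by
          rw [tsum_indicator_const_mul]
          gcongr
          exact tsum_indicator_Ici_dyadic_le r _ k
      _ = _ := by
          simp only [← mul_assoc (2 ^ _ * r), ← pow_succ']
          ring

lemma oscillation_le_tsum_top {m : ℕ} (hm : 1 ≤ m) {r C C' : ℝ≥0∞} {E O : ℕ → ℕ → ℝ≥0∞}
    (hE : ∀ h, 1 ≤ h → h ≤ m → ∀ k, E h k ≤ C * ∑' j, (Ici k).indicator (O h) j)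
    (hO : ∀ h < m, ∀ j, O h j ≤ C' * (2 ^ j * r) * E (h + 1) j) :
    O 0 0 ≤ C' * ((2 * C * C') ^ (m - 1) * C) * (r * ∑' j, (2 ^ j * r) ^ (m - 1) * O m j) := by
  refine (hO 0 hm 0).trans ?_
  have := averages_le_tsum_top hE hO (m - 1) 1 le_rfl (by omega) 0
  rw [pow_zero, one_mul, zero_add]
  refine (mul_le_mul_right this _).trans (le_of_eq ?_)
  have h0 : (Ici 0 : Set ℕ) = univ := by ext; simp
  simp only [h0, indicator_univ]
  ring

end Chain

section Derivatives

variable {n m : ℕ} {u : Euc n → ℝ} {D : (h : ℕ) → Euc n → (Fin h → Fin n) → ℝ}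

lemma HasWeakDerivs.hasWeakGrad (hD : HasWeakDerivs n m u D) {h : ℕ} (hm : h < m)
    (d : Fin h → Fin n) :
    HasWeakGrad (fun x => D h x d)
      (fun i x => D (h + 1) x (Fin.snoc (α := fun _ => Fin n) d i)) := by
  intro i φ hφ hc
  set e : Fin n → Euc n := fun i => EuclideanSpace.single i (1 : ℝ) with he
  have h1 := (hD.2 (h + 1) hm (Fin.snoc (α := fun _ => Fin n) d i)).2 φ hφ hc
  have hφ' : ContDiff ℝ (⊤ : ℕ∞) (fun x => fderiv ℝ φ x (e i)) :=
    (hφ.fderiv_right (m := (⊤ : ℕ∞)) (by simp)).clm_apply contDiff_const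
  have h2 := (hD.2 h hm.le d).2 (fun x => fderiv ℝ φ x (e i)) hφ' (hc.fderiv_apply ℝ _)
  have h3 : ∀ x, iteratedFDeriv ℝ (h + 1) φ x
      (fun j => e ((Fin.snoc (α := fun _ => Fin n) d i : Fin (h + 1) → Fin n) j)) =
      iteratedFDeriv ℝ h (fun x => fderiv ℝ φ x (e i)) x (fun j => e (d j)) := by
    intro x
    rw [iteratedFDeriv_succ_apply_right]
    have := (ContinuousLinearMap.apply ℝ ℝ (e i)).iteratedFDeriv_comp_left (n := (⊤ : ℕ∞))
      (f := fderiv ℝ φ) (x := x) (hφ.fderiv_right (m := (⊤ : ℕ∞)) (by simp)).contDiffAt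
      (i := h) (by exact_mod_cast le_top)
    have h4 : (⇑(ContinuousLinearMap.apply ℝ ℝ (e i)) ∘ fderiv ℝ φ) =
      fun x => fderiv ℝ φ x (e i) := rfl
    rw [h4] at this
    rw [this]
    simp [Fin.init_def]
  change ∫ x, u x * iteratedFDeriv ℝ (h + 1) φ x
      (fun j => e ((Fin.snoc (α := fun _ => Fin n) d i : Fin (h + 1) → Fin n) j)) = _ at h1
  simp only [h3] at h1
  rw [h1] at h2
  have h5 : ((-1 : ℝ) ^ h) * (-1 : ℝ) ^ h = 1 := by rw [← mul_pow]; simp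
  rw [pow_succ] at h2
  have := congrArg (fun z => (-1 : ℝ) ^ h * z) h2
  simp only [← mul_assoc, h5, one_mul] at this
  linarith

end Derivatives

section Young

lemma IsYoung.mono_s6 {A : ℝ → ℝ≥0∞} (hA : IsYoung A) {a b : ℝ} (ha : 0 ≤ a) (hab : a ≤ b) :
    A a ≤ A b := by
  rcases ha.eq_or_lt with rfl | ha'
  · rw [hA.1]; exact zero_le
  have hb : 0 < b := ha'.trans_le hab
  have h := hA.2.1 b 0 (a / b) hb.le le_rfl (by positivity) ((div_le_one hb).2 hab)
  rw [hA.1, mul_zero, mul_zero, add_zero, add_zero, div_mul_cancel₀ _ hb.ne'] at h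
  refine h.trans (mul_le_of_le_one_left' ?_)
  rw [ENNReal.ofReal_le_one]
  exact (div_le_one hb).2 hab

lemma youngConj_mono (A : ℝ → ℝ≥0∞) : Monotone (youngConj A) := by
  intro s t hst
  unfold youngConj
  refine iSup₂_mono fun τ hτ => ?_
  gcongr

lemma ofReal_mul_le_add_youngConj (A : ℝ → ℝ≥0∞) {a : ℝ} (ha : 0 ≤ a) (t : ℝ) :
    ENNReal.ofReal (a * t) ≤ A a + youngConj A t := by
  rw [← tsub_le_iff_left]
  exact le_iSup₂ (f := fun (τ : ℝ) (_ : 0 ≤ τ) => ENNReal.ofReal (τ * t) - A τ) a ha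

/-- A dyadic sum of the Young conjugate is controlled by the Young function `F`. -/
lemma tsum_youngConj_le_Fk {n : ℕ} {s : ℝ} (hs : s < (n : ℝ) + 1) (A : ℝ → ℝ≥0∞) {t : ℝ}
    (ht : 0 < t) :
    ∑' j : ℕ, ENNReal.ofReal (1 - 2 ^ (-((n : ℝ) + 1 - s))) * (2 ^ (n * j) *
      youngConj A (t * (2 ^ (-((n : ℝ) + 1 - s))) ^ (j + 1))) ≤ Fk n s 0 A t := by
  have hβ : 0 < (n : ℝ) + 1 - s := by linarith
  set c : ℝ := 2 ^ (-((n : ℝ) + 1 - s)) with hc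
  have hc0 : 0 < c := by positivity
  have hc1 : c < 1 := Real.rpow_lt_one_of_one_lt_of_neg one_lt_two (by linarith)
  unfold Fk
  set q : ℝ := (n : ℝ) / ((n : ℝ) - s + ((0 : ℕ) : ℝ) + 1) with hq
  have hcq : c ^ (-q) = 2 ^ n := by
    rw [hc, ← Real.rpow_mul two_pos.le, ← Real.rpow_natCast]
    congr 1
    rw [hq]
    have : (n : ℝ) - s + ((0 : ℕ) : ℝ) + 1 = (n : ℝ) + 1 - s := by push_cast; ring
    rw [this]
    field_simp
  set a : ℕ → ℝ := fun j => t * c ^ j with ha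
  have ha0 : ∀ j, 0 < a j := fun j => by positivity
  have hanti : Antitone a := by
    intro i j hij
    exact mul_le_mul_of_nonneg_left (pow_le_pow_of_le_one hc0.le hc1.le hij) ht.le
  have hterm : ∀ j : ℕ, ENNReal.ofReal (1 - c) * (2 ^ (n * j) * youngConj A (a (j + 1))) ≤
      ENNReal.ofReal (t ^ q) * ∫⁻ τ in Ioc (a (j + 1)) (a j),
        youngConj A τ * ENNReal.ofReal (τ ^ (-1 - q)) := by
    intro j
    have hreal : t ^ q * (a j ^ (-1 - q) * (a j - a (j + 1))) = (1 - c) * 2 ^ (n * j) := by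
      have h1 : a j - a (j + 1) = a j * (1 - c) := by simp only [ha, pow_succ]; ring
      have h2 : a j ^ (-1 - q) * a j = a j ^ (-q) := by
        rw [← Real.rpow_add_one (ha0 j).ne']; ring_nf
      have h3 : a j ^ (-q) = t ^ (-q) * 2 ^ (n * j) := by
        simp only [ha]
        rw [Real.mul_rpow ht.le (by positivity), ← Real.rpow_natCast c j, ← Real.rpow_mul hc0.le,
          mul_comm (j : ℝ), Real.rpow_mul hc0.le, hcq, Real.rpow_natCast, pow_mul]
      rw [h1, ← mul_assoc (a j ^ _), h2, h3]
      calc t ^ q * (t ^ (-q) * 2 ^ (n * j) * (1 - c))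
          = (t ^ q * t ^ (-q)) * ((1 - c) * 2 ^ (n * j)) := by ring
        _ = _ := by rw [← Real.rpow_add ht, add_neg_cancel, Real.rpow_zero, one_mul]
    calc ENNReal.ofReal (1 - c) * (2 ^ (n * j) * youngConj A (a (j + 1)))
        = ENNReal.ofReal ((1 - c) * 2 ^ (n * j)) * youngConj A (a (j + 1)) := by
          rw [ENNReal.ofReal_mul (by linarith), ENNReal.ofReal_pow two_pos.le,
            ENNReal.ofReal_ofNat, mul_assoc]
      _ = ENNReal.ofReal (t ^ q) * (youngConj A (a (j + 1)) * ENNReal.ofReal (a j ^ (-1 - q)) *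
            volume (Ioc (a (j + 1)) (a j))) := by
          rw [← hreal, Real.volume_Ioc, ENNReal.ofReal_mul (by positivity),
            ENNReal.ofReal_mul (Real.rpow_nonneg (ha0 j).le _)]
          ring
      _ ≤ _ := by
          gcongr
          rw [← setLIntegral_const]
          refine setLIntegral_mono' measurableSet_Ioc fun τ hτ => ?_
          have hτ0 : 0 < τ := (ha0 _).trans hτ.1
          refine mul_le_mul' (youngConj_mono A hτ.1.le) (ENNReal.ofReal_le_ofReal ?_)
          refine Real.rpow_le_rpow_of_nonpos hτ0 hτ.2 ?_
          have : 0 ≤ q := div_nonneg (Nat.cast_nonneg n) (by push_cast; linarith)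
          linarith
  refine (ENNReal.tsum_le_tsum hterm).trans ?_
  rw [ENNReal.tsum_mul_left]
  gcongr
  have hdisj : Pairwise (Function.onFun Disjoint fun j => Ioc (a (j + 1)) (a j)) :=
    hanti.pairwise_disjoint_on_Ioc_succ
  rw [← lintegral_iUnion (fun _ => measurableSet_Ioc) hdisj]
  refine lintegral_mono_set (iUnion_subset fun j => ?_)
  refine Ioc_subset_Ioc (ha0 _).le ?_
  simpa [ha] using hanti (Nat.zero_le j)

end Young

section Scales

lemma sum_lintegral_le_lintegral_sum {α ι : Type*} [MeasurableSpace α] {μ : Measure α}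
    (s : Finset ι) (f : ι → α → ℝ≥0∞) :
    ∑ i ∈ s, ∫⁻ x, f i x ∂μ ≤ ∫⁻ x, ∑ i ∈ s, f i x ∂μ := by
  classical
  induction s using Finset.induction_on with
  | empty => simp
  | insert i s hi ih =>
    simp only [Finset.sum_insert hi]
    exact (add_le_add_right ih _).trans (le_lintegral_add _ _)

lemma tsum_dyadic_volume_inv_le {n : ℕ} (hn : 0 < n) (x₀ : Euc n) {r d : ℝ} (hr : 0 < r)
    (hd : 0 < d) :
    ∑' j : ℕ, (if d ≤ 2 * (2 ^ j * r) then (volume (ball x₀ (2 ^ j * r)))⁻¹ else 0) ≤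
      2 ^ (n + 1) * (volume (ball (0 : Euc n) 1))⁻¹ * (ENNReal.ofReal (d ^ (n : ℝ)))⁻¹ := by
  set f : ℕ → ℝ≥0∞ := fun j => if d ≤ 2 * (2 ^ j * r) then (volume (ball x₀ (2 ^ j * r)))⁻¹ else 0
  have hex : ∃ j : ℕ, d ≤ 2 * (2 ^ j * r) := by
    obtain ⟨j, hj⟩ := pow_unbounded_of_one_lt (d / r) (one_lt_two (α := ℝ))
    refine ⟨j, ?_⟩
    rw [div_lt_iff₀ hr] at hj
    linarith
  classical
  set j₀ := Nat.find hex with hj₀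
  have hmin : ∀ j < j₀, f j = 0 := fun j hj => if_neg (Nat.find_min hex hj)
  have hspec : d ≤ 2 * (2 ^ j₀ * r) := Nat.find_spec hex
  rw [← ENNReal.summable.sum_add_tsum_nat_add' (k := j₀),
    Finset.sum_eq_zero fun j hj => hmin j (Finset.mem_range.1 hj), zero_add]
  have hd2 : volume (ball x₀ (d / 2)) =
      ENNReal.ofReal ((d / 2) ^ n) * volume (ball (0 : Euc n) 1) := by
    rw [← volume_ball_mul x₀ 0 (by positivity), mul_one]
  have hterm : ∀ i, f (i + j₀) ≤ (2⁻¹ : ℝ≥0∞) ^ i * (volume (ball x₀ (d / 2)))⁻¹ := by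
    intro i
    simp only [f]
    split_ifs
    · rw [← ENNReal.inv_pow, ← ENNReal.mul_inv (by simp) (by simp)]
      refine ENNReal.inv_le_inv' ?_
      rw [pow_add, mul_assoc, volume_ball_two_pow]
      gcongr
      · exact one_le_two
      · exact Nat.le_mul_of_pos_left _ hn
      · linarith
    · exact zero_le
  refine (ENNReal.tsum_le_tsum hterm).trans (le_of_eq ?_)
  rw [ENNReal.tsum_mul_right, ENNReal.tsum_geometric, ENNReal.one_sub_inv_two, inv_inv, hd2,
    ENNReal.mul_inv (Or.inr measure_ball_lt_top.ne) (by simp), Real.rpow_natCast, div_pow,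
    ENNReal.ofReal_div_of_pos
    (by positivity), ENNReal.inv_div (by simp) (by simp), ENNReal.div_eq_inv_mul,
    ENNReal.ofReal_pow two_pos.le, ENNReal.ofReal_ofNat]
  ring

/-- Summing over dyadic scales the mean values of `A` of the normalized differences. -/
lemma tsum_setLAverage_le_Jfun {n : ℕ} (hn : 0 < n) {σ : ℝ} (hσ : 0 ≤ σ) {A : ℝ → ℝ≥0∞}
    (hA : IsYoung A) {ι : Type} [Fintype ι] (w : Euc n → ι → ℝ) (x₀ : Euc n) {r : ℝ}
    (hr : 0 < r) :
    ∑' j : ℕ, volume (ball x₀ (2 ^ j * r)) * ⨍⁻ x in ball x₀ (2 ^ j * r),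
      ⨍⁻ y in ball x₀ (2 ^ j * r), A (√(∑ i, (w x i - w y i) ^ 2) / (2 * (2 ^ j * r)) ^ σ)
        ∂volume ∂volume ≤
      2 ^ (n + 1) * (volume (ball (0 : Euc n) 1))⁻¹ * Jfun n σ A w := by
  set B : ℕ → Set (Euc n) := fun j => ball x₀ (2 ^ j * r)
  set P : Euc n → Euc n → ℝ := fun x y => √(∑ i, (w x i - w y i) ^ 2) with hP
  set K : ℝ≥0∞ := 2 ^ (n + 1) * (volume (ball (0 : Euc n) 1))⁻¹
  have hK : K ≠ ⊤ := ENNReal.mul_ne_top (by simp)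
    (ENNReal.inv_ne_top.2 (measure_ball_pos _ _ one_pos).ne')
  have hB0 : ∀ j, volume (B j) ≠ 0 := fun j => (measure_ball_pos _ _ (by positivity)).ne'
  have hB1 : ∀ j, volume (B j) ≠ ⊤ := fun j => measure_ball_lt_top.ne
  have hBm : ∀ j, MeasurableSet (B j) := fun _ => measurableSet_ball
  set g : ℕ → Euc n → Euc n → ℝ≥0∞ := fun j x y =>
    (if ‖x - y‖ ≤ 2 * (2 ^ j * r) then (volume (B j))⁻¹ else 0) * A (P x y / ‖x - y‖ ^ σ)
  have hterm : ∀ j, volume (B j) * ⨍⁻ x in B j, ⨍⁻ y in B j,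
      A (P x y / (2 * (2 ^ j * r)) ^ σ) ∂volume ∂volume ≤ ∫⁻ x, ∫⁻ y, g j x y := by
    intro j
    simp only [setLAverage_eq]
    rw [ENNReal.mul_div_cancel (hB0 j) (hB1 j), ← lintegral_indicator (hBm j)]
    refine lintegral_mono fun x => ?_
    by_cases hx : x ∈ B j
    · simp only [hx, indicator_of_mem, ENNReal.div_eq_inv_mul]
      rw [← lintegral_const_mul' _ _ (ENNReal.inv_ne_top.2 (hB0 j)),
        ← lintegral_indicator (hBm j)]
      refine lintegral_mono fun y => ?_
      by_cases hy : y ∈ B j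
      · have hxy : ‖x - y‖ ≤ 2 * (2 ^ j * r) := by
          rw [← dist_eq_norm]
          have := dist_triangle_right x y x₀
          simp only [B, mem_ball] at hx hy
          linarith
        simp only [hy, indicator_of_mem, g, if_pos hxy]
        gcongr
        rcases eq_or_ne x y with rfl | hne
        · simp [hP]
        · refine hA.mono_s6 (by positivity) ?_
          have : 0 < ‖x - y‖ := norm_pos_iff.2 (sub_ne_zero.2 hne)
          gcongr
      · simp [hy]
    · simp [hx]
  refine (ENNReal.tsum_le_tsum hterm).trans ?_
  rw [ENNReal.tsum_eq_iSup_sum]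
  refine iSup_le fun S => ?_
  calc ∑ j ∈ S, ∫⁻ x, ∫⁻ y, g j x y ≤ ∫⁻ x, ∫⁻ y, ∑ j ∈ S, g j x y :=
        (sum_lintegral_le_lintegral_sum _ _).trans
          (lintegral_mono fun x => sum_lintegral_le_lintegral_sum _ _)
    _ ≤ ∫⁻ x, ∫⁻ y, K * (A (P x y / ‖x - y‖ ^ σ) / ENNReal.ofReal (‖x - y‖ ^ (n : ℝ))) := by
        refine lintegral_mono fun x => lintegral_mono fun y => ?_
        simp only [g, ← Finset.sum_mul]
        rcases eq_or_ne x y with rfl | hne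
        · simp [hP, hA.1]
        · rw [ENNReal.div_eq_inv_mul, ← mul_assoc]
          gcongr
          exact (ENNReal.sum_le_tsum S).trans
            (tsum_dyadic_volume_inv_le hn x₀ hr (norm_pos_iff.2 (sub_ne_zero.2 hne)))
    _ = _ := by
        simp only [lintegral_const_mul' _ _ hK]
        rfl

end Scales

section Chaining

variable {n m : ℕ} {u : Euc n → ℝ} {D : (h : ℕ) → Euc n → (Fin h → Fin n) → ℝ}

lemma sum_sum_snoc {h : ℕ} (f : (Fin (h + 1) → Fin n) → ℝ≥0∞) :
    ∑ d : Fin h → Fin n, ∑ i, f (Fin.snoc (α := fun _ => Fin n) d i) = ∑ d, f d := by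
  rw [Finset.sum_comm, ← Fintype.sum_prod_type']
  exact Fintype.sum_equiv (Fin.snocEquiv fun _ => Fin n) _ _ fun _ => rfl

lemma DecayFrom.component (hdec : DecayFrom n 1 m D) {h : ℕ} (h1 : 1 ≤ h) (hm : h ≤ m)
    (d : Fin h → Fin n) {t : ℝ} (ht : 0 < t) : volume {x | t < |D h x d|} < ⊤ := by
  refine (measure_mono fun x hx => ?_).trans_lt (hdec h h1 hm t ht)
  refine lt_of_lt_of_le hx (Real.abs_le_sqrt ?_)
  exact Finset.single_le_sum (f := fun d => D h x d ^ 2) (fun _ _ => sq_nonneg _)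
    (Finset.mem_univ d)

/-- The mean oscillation of `u` is controlled by the mean oscillations, at larger dyadic scales,
of its derivatives of top order. -/
lemma HasWeakDerivs.oscillation_le_tsum (hn : 0 < n) (hm : 1 ≤ m) (hD : HasWeakDerivs n m u D)
    (hdec : DecayFrom n 1 m D) (x₀ : Euc n) {r : ℝ} (hr : 0 < r) :
    ⨍⁻ x in ball x₀ r, ⨍⁻ y in ball x₀ r, ‖u x - u y‖ₑ ∂volume ∂volume ≤
      2 ^ (n + 1) * ((2 * (2 ^ n + 2) * 2 ^ (n + 1)) ^ (m - 1) * (2 ^ n + 2)) *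
        (ENNReal.ofReal r * ∑' j : ℕ, (2 ^ j * ENNReal.ofReal r) ^ (m - 1) *
          ∑ d, ⨍⁻ x in ball x₀ (2 ^ j * r), ⨍⁻ y in ball x₀ (2 ^ j * r),
            ‖D m x d - D m y d‖ₑ ∂volume ∂volume) := by
  set O : ℕ → ℕ → ℝ≥0∞ := fun h j => ∑ d, ⨍⁻ x in ball x₀ (2 ^ j * r),
    ⨍⁻ y in ball x₀ (2 ^ j * r), ‖D h x d - D h y d‖ₑ ∂volume ∂volume with hOdef
  set E : ℕ → ℕ → ℝ≥0∞ := fun h j => ∑ d, ⨍⁻ x in ball x₀ (2 ^ j * r), ‖D h x d‖ₑ ∂volume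
  have hE : ∀ h, 1 ≤ h → h ≤ m → ∀ k,
      E h k ≤ (2 ^ n + 2) * ∑' j, (Ici k).indicator (O h) j := by
    intro h h1 hhm k
    refine (Finset.sum_le_sum fun d _ => setLAverage_ball_le_tsum hn (hD.2 h hhm d).1
      (fun t ht => hdec.component h1 hhm d ht) x₀ hr k).trans (le_of_eq ?_)
    rw [← Finset.mul_sum, ← Summable.tsum_finsetSum fun _ _ => ENNReal.summable]
    congr 1
    refine tsum_congr fun j => ?_
    by_cases hj : j ∈ Ici k
    · simp only [indicator_of_mem hj, O]
    · simp only [indicator_of_notMem hj, Finset.sum_const_zero]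
  have hO : ∀ h < m, ∀ j, O h j ≤ 2 ^ (n + 1) * (2 ^ j * ENNReal.ofReal r) * E (h + 1) j := by
    intro h hh j
    refine (Finset.sum_le_sum fun d _ => setLAverage_ball_sub_le (hD.hasWeakGrad hh d)
      (hD.2 h hh.le d).1 (fun i => (hD.2 (h + 1) hh _).1) x₀ (by positivity)).trans (le_of_eq ?_)
    rw [← Finset.mul_sum, ENNReal.ofReal_mul (by positivity), ENNReal.ofReal_pow two_pos.le,
      ENNReal.ofReal_ofNat, sum_sum_snoc fun d =>
        ⨍⁻ x in ball x₀ (2 ^ j * r), ‖D (h + 1) x d‖ₑ ∂volume]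
  refine le_trans (le_of_eq ?_) (oscillation_le_tsum_top hm hE hO)
  simp [hOdef, hD.1]

end Chaining

section Combine

/-- Young's inequality, summed over the dyadic scales. -/
lemma tsum_volume_mul_setLAverage_le {n : ℕ} (hn : 0 < n) {s σ : ℝ} (hs : s < (n : ℝ) + 1)
    (hσ : 0 ≤ σ) {A : ℝ → ℝ≥0∞} (hA : IsYoung A) {ι : Type} [Fintype ι] (w : Euc n → ι → ℝ)
    (hJ : Jfun n σ A w ≤ 1) (x₀ : Euc n) {r t : ℝ} (hr : 0 < r) (ht : 0 < t)
    (hF : volume (ball x₀ r) * Fk n s 0 A t ≤ 1) :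
    ∑' j : ℕ, volume (ball x₀ (2 ^ j * r)) * ⨍⁻ x in ball x₀ (2 ^ j * r),
      ⨍⁻ y in ball x₀ (2 ^ j * r), ENNReal.ofReal (√(∑ i, (w x i - w y i) ^ 2) /
        (2 * (2 ^ j * r)) ^ σ * (t * (2 ^ (-((n : ℝ) + 1 - s))) ^ (j + 1))) ∂volume ∂volume ≤
      2 ^ (n + 1) * (volume (ball (0 : Euc n) 1))⁻¹ +
        (ENNReal.ofReal (1 - 2 ^ (-((n : ℝ) + 1 - s))))⁻¹ := by
  set c : ℝ := 2 ^ (-((n : ℝ) + 1 - s)) with hc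
  set τ : ℕ → ℝ := fun j => t * c ^ (j + 1) with hτ
  have hB0 : ∀ j : ℕ, volume (ball x₀ (2 ^ j * r)) ≠ 0 :=
    fun j => (measure_ball_pos _ _ (by positivity)).ne'
  have hB1 : ∀ j : ℕ, volume (ball x₀ (2 ^ j * r)) ≠ ⊤ := fun j => measure_ball_lt_top.ne
  have hterm : ∀ j : ℕ, ⨍⁻ x in ball x₀ (2 ^ j * r), ⨍⁻ y in ball x₀ (2 ^ j * r),
      ENNReal.ofReal (√(∑ i, (w x i - w y i) ^ 2) / (2 * (2 ^ j * r)) ^ σ * τ j)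
        ∂volume ∂volume ≤
      (⨍⁻ x in ball x₀ (2 ^ j * r), ⨍⁻ y in ball x₀ (2 ^ j * r),
        A (√(∑ i, (w x i - w y i) ^ 2) / (2 * (2 ^ j * r)) ^ σ) ∂volume ∂volume) +
      youngConj A (τ j) := by
    intro j
    have hconst := setLAverage_const (hB0 j) (hB1 j) (youngConj A (τ j))
    rw [setLAverage_eq'] at hconst
    simp only [setLAverage_eq']
    calc _ ≤ ∫⁻ x, ((∫⁻ y, A (√(∑ i, (w x i - w y i) ^ 2) / (2 * (2 ^ j * r)) ^ σ)
            ∂(volume (ball x₀ (2 ^ j * r)))⁻¹ • volume.restrict (ball x₀ (2 ^ j * r))) +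
            youngConj A (τ j))
            ∂(volume (ball x₀ (2 ^ j * r)))⁻¹ • volume.restrict (ball x₀ (2 ^ j * r)) := by
          refine lintegral_mono fun x => ?_
          refine (lintegral_mono fun y =>
            ofReal_mul_le_add_youngConj A (by positivity) (τ j)).trans ?_
          rw [lintegral_add_right _ measurable_const, hconst]
      _ = _ := by rw [lintegral_add_right _ measurable_const, hconst]
  refine (ENNReal.tsum_le_tsum fun j => mul_le_mul_right (hterm j) _).trans ?_
  simp only [mul_add]
  rw [ENNReal.tsum_add]
  refine add_le_add ?_ ?_
  · refine (tsum_setLAverage_le_Jfun hn hσ hA w x₀ hr).trans ?_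
    exact mul_le_of_le_one_right' hJ
  · rw [ENNReal.le_inv_iff_mul_le]
    refine le_trans (le_of_eq ?_) ((mul_le_mul_right (tsum_youngConj_le_Fk hs A ht) _).trans hF)
    rw [← ENNReal.tsum_mul_right, ← ENNReal.tsum_mul_left]
    refine tsum_congr fun j => ?_
    rw [volume_ball_two_pow]
    ring

end Combine

section MainEstimate

lemma dyadic_scaling_identity {n m : ℕ} (hm : 1 ≤ m) {s r lam κ t : ℝ} (hr : 0 < r)
    (hκ : 0 < κ) (ht : 0 < t) (j : ℕ) :
    r * (2 ^ j * r) ^ (m - 1) * (lam * (2 * (2 ^ j * r)) ^ (s - m) /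
        (t * (2 ^ (-((n : ℝ) + 1 - s))) ^ (j + 1))) =
      lam * 2 ^ ((s - m) + ((n : ℝ) + 1 - s)) * r ^ (s - n) / (κ * t) *
        (κ * (2 ^ j * r) ^ n) := by
  set ρ : ℝ := 2 ^ j * r with hρ
  have hρ0 : 0 < ρ := by positivity
  have h2 : (2 : ℝ) ^ (j + 1) = 2 * (ρ / r) := by rw [hρ, pow_succ]; field_simp
  have hc : ((2 : ℝ) ^ (-((n : ℝ) + 1 - s))) ^ (j + 1) =
      (2 ^ ((n : ℝ) + 1 - s) * (ρ ^ ((n : ℝ) + 1 - s) / r ^ ((n : ℝ) + 1 - s)))⁻¹ := by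
    rw [← Real.rpow_natCast, ← Real.rpow_mul two_pos.le, mul_comm, Real.rpow_mul two_pos.le,
      Real.rpow_natCast, h2, Real.rpow_neg (by positivity),
      Real.mul_rpow two_pos.le (by positivity),
      Real.div_rpow hρ0.le hr.le]
  have hρn : ρ ^ (m - 1) * ρ ^ (s - m) * ρ ^ ((n : ℝ) + 1 - s) = ρ ^ n := by
    rw [← Real.rpow_natCast, ← Real.rpow_natCast, ← Real.rpow_add hρ0, ← Real.rpow_add hρ0,
      Nat.cast_sub hm]
    congr 1
    push_cast
    ring
  have hrn : r * (r ^ ((n : ℝ) + 1 - s))⁻¹ = r ^ (s - n) := by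
    rw [← Real.rpow_neg hr.le, mul_comm, ← Real.rpow_add_one hr.ne']
    congr 1
    ring
  rw [hc, Real.mul_rpow two_pos.le hρ0.le, Real.rpow_add two_pos, ← hρn, ← hrn]
  field_simp

lemma HasWeakDerivs.setLAverage_sub_le {n m : ℕ} (hn : 0 < n) (hm : 1 ≤ m) {s : ℝ}
    (hs : s < (n : ℝ) + 1) (hσ : (m : ℝ) ≤ s) {A : ℝ → ℝ≥0∞} (hA : IsYoung A) {u : Euc n → ℝ}
    {D : (h : ℕ) → Euc n → (Fin h → Fin n) → ℝ} (hD : HasWeakDerivs n m u D)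
    (hdec : DecayFrom n 1 m D) {lam : ℝ} (hlam : 0 < lam)
    (hJ : Jfun n (s - m) A (fun x i => D m x i / lam) ≤ 1) (x₀ : Euc n) {r t : ℝ}
    (hr : 0 < r) (ht : 0 < t) (hF : volume (ball x₀ r) * Fk n s 0 A t ≤ 1) :
    ⨍⁻ x in ball x₀ r, ⨍⁻ y in ball x₀ r, ‖u x - u y‖ₑ ∂volume ∂volume ≤
      2 ^ (n + 1) * ((2 * (2 ^ n + 2) * 2 ^ (n + 1)) ^ (m - 1) * (2 ^ n + 2)) *
        (Fintype.card (Fin m → Fin n) * (2 ^ (n + 1) * (volume (ball (0 : Euc n) 1))⁻¹ +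
          (ENNReal.ofReal (1 - 2 ^ (-((n : ℝ) + 1 - s))))⁻¹)) *
        ENNReal.ofReal (lam * 2 ^ ((s - m) + ((n : ℝ) + 1 - s)) * r ^ (s - n) /
          ((volume (ball (0 : Euc n) 1)).toReal * t)) := by
  set ω := volume (ball (0 : Euc n) 1) with hω
  have hω1 : ω ≠ ⊤ := measure_ball_lt_top.ne
  have hκ : 0 < ω.toReal := ENNReal.toReal_pos (measure_ball_pos _ _ one_pos).ne' hω1
  set Z : ℝ := lam * 2 ^ ((s - m) + ((n : ℝ) + 1 - s)) * r ^ (s - n) / (ω.toReal * t) with hZ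
  have hZ0 : 0 ≤ Z := by positivity
  set w : Euc n → (Fin m → Fin n) → ℝ := fun x i => D m x i / lam with hw
  set τ : ℕ → ℝ := fun j => t * (2 ^ (-((n : ℝ) + 1 - s))) ^ (j + 1) with hτ
  have hτ0 : ∀ j, 0 < τ j := fun j => by positivity
  set b : ℕ → ℝ≥0∞ := fun j => ⨍⁻ x in ball x₀ (2 ^ j * r), ⨍⁻ y in ball x₀ (2 ^ j * r),
    ENNReal.ofReal (√(∑ i, (w x i - w y i) ^ 2) / (2 * (2 ^ j * r)) ^ (s - m) * τ j)
      ∂volume ∂volume with hb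
  have hcomb := tsum_volume_mul_setLAverage_le hn hs (sub_nonneg.2 hσ) hA w hJ x₀ hr ht hF
  have hpt : ∀ (j : ℕ) (d : Fin m → Fin n) (x y : Euc n), ‖D m x d - D m y d‖ₑ ≤
      ENNReal.ofReal (lam * (2 * (2 ^ j * r)) ^ (s - m) / τ j) *
        ENNReal.ofReal (√(∑ i, (w x i - w y i) ^ 2) / (2 * (2 ^ j * r)) ^ (s - m) * τ j) := by
    intro j d x y
    have h1 : |w x d - w y d| ≤ √(∑ i, (w x i - w y i) ^ 2) :=
      Real.abs_le_sqrt (Finset.single_le_sum (f := fun d => (w x d - w y d) ^ 2)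
        (fun _ _ => sq_nonneg _) (Finset.mem_univ d))
    have hq : (0 : ℝ) < (2 * (2 ^ j * r)) ^ (s - m) := by positivity
    have h2 : |D m x d - D m y d| = lam * |w x d - w y d| := by
      have : D m x d - D m y d = lam * (w x d - w y d) := by
        simp only [hw]
        field_simp
      rw [this, abs_mul, abs_of_pos hlam]
    have hτj := (hτ0 j).ne'
    rw [← ENNReal.ofReal_mul (by have := hτ0 j; positivity), Real.enorm_eq_ofReal_abs, h2]
    refine ENNReal.ofReal_le_ofReal (le_trans (mul_le_mul_of_nonneg_left h1 hlam.le) (le_of_eq ?_))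
    field_simp
  have hO : ∀ j : ℕ, ∑ d, ⨍⁻ x in ball x₀ (2 ^ j * r), ⨍⁻ y in ball x₀ (2 ^ j * r),
      ‖D m x d - D m y d‖ₑ ∂volume ∂volume ≤ Fintype.card (Fin m → Fin n) *
        (ENNReal.ofReal (lam * (2 * (2 ^ j * r)) ^ (s - m) / τ j) * b j) := by
    intro j
    rw [← nsmul_eq_mul]
    refine Finset.sum_le_card_nsmul _ _ _ fun d _ => ?_
    simp only [hb, setLAverage_eq']
    rw [← lintegral_const_mul' _ _ ENNReal.ofReal_ne_top]
    refine lintegral_mono fun x => ?_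
    rw [← lintegral_const_mul' _ _ ENNReal.ofReal_ne_top]
    exact lintegral_mono fun y => hpt j d x y
  have hvol : ∀ j : ℕ, volume (ball x₀ (2 ^ j * r)) =
      ENNReal.ofReal (ω.toReal * (2 ^ j * r) ^ n) := by
    intro j
    have := volume_ball_mul x₀ (0 : Euc n) (a := 2 ^ j * r) (by positivity) 1
    rw [mul_one] at this
    rw [this, ENNReal.ofReal_mul hκ.le, ENNReal.ofReal_toReal hω1, mul_comm]
  refine (hD.oscillation_le_tsum hn hm hdec x₀ hr).trans ?_
  rw [mul_assoc _ _ (ENNReal.ofReal Z)]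
  refine mul_le_mul_right ?_ _
  calc _ ≤ ENNReal.ofReal r * ∑' j : ℕ, (2 ^ j * ENNReal.ofReal r) ^ (m - 1) *
        (Fintype.card (Fin m → Fin n) *
          (ENNReal.ofReal (lam * (2 * (2 ^ j * r)) ^ (s - m) / τ j) * b j)) := by
        exact mul_le_mul_right (ENNReal.tsum_le_tsum fun j => mul_le_mul_right (hO j) _) _
    _ = Fintype.card (Fin m → Fin n) *
        (ENNReal.ofReal Z * ∑' j : ℕ, volume (ball x₀ (2 ^ j * r)) * b j) := by
        simp only [← ENNReal.tsum_mul_left]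
        refine tsum_congr fun j => ?_
        have hid := congrArg ENNReal.ofReal
          (dyadic_scaling_identity (n := n) (s := s) (lam := lam) hm hr hκ ht j)
        rw [← hZ, ENNReal.ofReal_mul (by positivity), ENNReal.ofReal_mul (by positivity),
          ENNReal.ofReal_mul hZ0, ← hvol, ENNReal.ofReal_pow (by positivity),
          ENNReal.ofReal_mul (by positivity), ENNReal.ofReal_pow two_pos.le,
          ENNReal.ofReal_ofNat] at hid
        rw [← mul_assoc (ENNReal.ofReal Z), ← hid]
        ring
    _ ≤ _ := by
        rw [mul_assoc, mul_comm (ENNReal.ofReal Z)]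
        gcongr

lemma ofReal_setAverage_abs_sub_le {α : Type*} [MeasurableSpace α] {μ : Measure α} {S : Set α}
    (h0 : μ S ≠ 0) (h1 : μ S ≠ ⊤) {u : α → ℝ} (hu : IntegrableOn u S μ) :
    ENNReal.ofReal (⨍ y in S, |u y - ⨍ z in S, u z ∂μ| ∂μ) ≤
      ⨍⁻ x in S, ⨍⁻ y in S, ‖u x - u y‖ₑ ∂μ ∂μ := by
  simp only [setLAverage_eq', setAverage_eq']
  have hp : IsProbabilityMeasure ((μ S)⁻¹ • μ.restrict S) :=
    ⟨by simp [ENNReal.inv_mul_cancel h0 h1]⟩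
  have hint : Integrable u ((μ S)⁻¹ • μ.restrict S) :=
    hu.smul_measure (ENNReal.inv_ne_top.2 h0)
  refine (Real.ofReal_le_enorm _).trans ((enorm_integral_le_lintegral_enorm _).trans ?_)
  refine lintegral_mono fun x => ?_
  rw [Real.enorm_abs]
  have : u x - ∫ z, u z ∂(μ S)⁻¹ • μ.restrict S =
      ∫ z, (u x - u z) ∂(μ S)⁻¹ • μ.restrict S := by
    rw [integral_sub (integrable_const _) hint]
    simp
  rw [this]
  exact enorm_integral_le_lintegral_enorm _

lemma ofReal_oscQuot_le {n : ℕ} (hn : 0 < n) {s : ℝ} {A : ℝ → ℝ≥0∞} {u : Euc n → ℝ}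
    (hu : LocallyIntegrable u) (x₀ : Euc n) {r b : ℝ} {K : ℝ≥0∞} (hr : 0 < r)
    (h : ∀ t : ℝ, 0 < t → volume (ball x₀ r) * Fk n s 0 A t ≤ 1 →
      ⨍⁻ x in ball x₀ r, ⨍⁻ y in ball x₀ r, ‖u x - u y‖ₑ ∂volume ∂volume ≤
        K * ENNReal.ofReal (b * r ^ (s - n) / ((volume (ball (0 : Euc n) 1)).toReal * t))) :
    ENNReal.ofReal (oscQuot n (psiK n s 0 A) u x₀ r) ≤
      K * ENNReal.ofReal (2 * b * (((volume (ball (0 : Euc n) 1)).toReal ^ ((n : ℝ)⁻¹)) ^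
        ((n : ℝ) - s) / (volume (ball (0 : Euc n) 1)).toReal)) := by
  set ω := volume (ball (0 : Euc n) 1)
  have hω1 : ω ≠ ⊤ := measure_ball_lt_top.ne
  have hκ : 0 < ω.toReal := ENNReal.toReal_pos (measure_ball_pos _ _ one_pos).ne' hω1
  have hn' : (n : ℝ) ≠ 0 := by positivity
  have hV0 : volume (ball x₀ r) ≠ 0 := (measure_ball_pos _ _ hr).ne'
  have hV1 : volume (ball x₀ r) ≠ ⊤ := measure_ball_lt_top.ne
  have hV : (volume (ball x₀ r)).toReal = ω.toReal * r ^ n := by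
    have := volume_ball_mul x₀ (0 : Euc n) (a := r) hr 1
    rw [mul_one] at this
    rw [this, ENNReal.toReal_mul, ENNReal.toReal_ofReal (by positivity), mul_comm]
  have hR : (volume (ball x₀ r)).toReal ^ ((n : ℝ)⁻¹) = ω.toReal ^ ((n : ℝ)⁻¹) * r := by
    rw [hV, Real.mul_rpow hκ.le (by positivity), Real.pow_rpow_inv_natCast hr.le hn.ne']
  have hRn : ((volume (ball x₀ r)).toReal ^ ((n : ℝ)⁻¹)) ^ (-(n : ℝ)) =
      (volume (ball x₀ r)).toReal⁻¹ := by
    rw [← Real.rpow_mul ENNReal.toReal_nonneg, mul_neg, inv_mul_cancel₀ hn', Real.rpow_neg_one]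
  unfold oscQuot psiK
  rw [inv_inv, hRn, hR, Nat.cast_zero, add_zero]
  set T := rcInv (Fk n s 0 A) (ENNReal.ofReal (volume (ball x₀ r)).toReal⁻¹) with hT
  have hT0 : 0 ≤ T := Real.sInf_nonneg fun τ hτ => hτ.1
  rcases hT0.eq_or_lt with h0 | hTpos
  · rw [← h0]
    simp
  have hF : volume (ball x₀ r) * Fk n s 0 A (T / 2) ≤ 1 := by
    have hnot : T / 2 ∉ {τ : ℝ | 0 ≤ τ ∧
        ENNReal.ofReal (volume (ball x₀ r)).toReal⁻¹ < Fk n s 0 A τ} :=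
      notMem_of_lt_csInf (half_lt_self hTpos) ⟨0, fun τ hτ => hτ.1⟩
    have hle : Fk n s 0 A (T / 2) ≤ ENNReal.ofReal (volume (ball x₀ r)).toReal⁻¹ :=
      not_lt.1 fun hlt => hnot ⟨by positivity, hlt⟩
    rw [ENNReal.ofReal_inv_of_pos (ENNReal.toReal_pos hV0 hV1), ENNReal.ofReal_toReal hV1] at hle
    rw [mul_comm]
    exact ENNReal.le_inv_iff_mul_le.1 hle
  have hosc := (ofReal_setAverage_abs_sub_le hV0 hV1
    ((hu.integrableOn_isCompact (isCompact_closedBall x₀ r)).mono_set ball_subset_closedBall)).trans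
      (h (T / 2) (by positivity) hF)
  rw [ENNReal.ofReal_mul (by positivity)]
  refine (mul_le_mul_right hosc _).trans (le_of_eq ?_)
  rw [mul_left_comm, ← ENNReal.ofReal_mul (by positivity)]
  congr 2
  have hrr : r ^ ((n : ℝ) - s) * r ^ (s - n) = 1 := by
    rw [← Real.rpow_add hr, sub_add_sub_cancel, sub_self, Real.rpow_zero]
  rw [Real.mul_rpow (by positivity) hr.le]
  calc (ω.toReal ^ ((n : ℝ)⁻¹)) ^ ((n : ℝ) - s) * r ^ ((n : ℝ) - s) * T *
        (b * r ^ (s - n) / (ω.toReal * (T / 2)))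
      = (r ^ ((n : ℝ) - s) * r ^ (s - n)) *
        (2 * b * ((ω.toReal ^ ((n : ℝ)⁻¹)) ^ ((n : ℝ) - s) / ω.toReal)) := by field_simp
    _ = _ := by rw [hrr, one_mul]

end MainEstimate

/-- Optimal embedding of `V^{s,A}_{d,1}(ℝⁿ)` into the Campanato space
`𝓛^{ψ_{s,A}}(ℝⁿ)` for `s ∈ (1,n+1) \ ℕ`. -/
theorem stmt6 (n : ℕ) (hn : 0 < n) (s : ℝ) (hs : s ∈ Set.Ioo (1 : ℝ) ((n : ℝ) + 1))
    (hs2 : ∀ m : ℕ, s ≠ (m : ℝ)) :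
    ∃ c : ℝ, 0 < c ∧ ∀ A : ℝ → ℝ≥0∞, IsYoung A → IntCondK n s 0 A →
      ∀ (u : Euc n → ℝ) (D : (h : ℕ) → Euc n → (Fin h → Fin n) → ℝ),
        HasWeakDerivs n ⌊s⌋₊ u D → DecayFrom n 1 ⌊s⌋₊ D →
        fracSem n (s - (⌊s⌋₊ : ℝ)) A (D ⌊s⌋₊) < ⊤ →
        campSem n (psiK n s 0 A) u ≤
          ENNReal.ofReal c * fracSem n (s - (⌊s⌋₊ : ℝ)) A (D ⌊s⌋₊) := by
  set m := ⌊s⌋₊ with hm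
  have hm1 : 1 ≤ m := Nat.le_floor (by exact_mod_cast hs.1.le)
  have hσ : (m : ℝ) ≤ s := Nat.floor_le (by linarith [hs.1])
  set ω := volume (ball (0 : Euc n) 1) with hω
  have hω0 : ω ≠ 0 := (measure_ball_pos _ _ one_pos).ne'
  have hc1 : (2 : ℝ) ^ (-((n : ℝ) + 1 - s)) < 1 :=
    Real.rpow_lt_one_of_one_lt_of_neg one_lt_two (by linarith [hs.2])
  set K : ℝ≥0∞ := 2 ^ (n + 1) * ((2 * (2 ^ n + 2) * 2 ^ (n + 1)) ^ (m - 1) * (2 ^ n + 2)) *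
    (Fintype.card (Fin m → Fin n) * (2 ^ (n + 1) * ω⁻¹ +
      (ENNReal.ofReal (1 - 2 ^ (-((n : ℝ) + 1 - s))))⁻¹)) with hK
  have hKtop : K ≠ ⊤ := by
    have h1 : ω⁻¹ ≠ ⊤ := ENNReal.inv_ne_top.2 hω0
    have h2 : (ENNReal.ofReal (1 - 2 ^ (-((n : ℝ) + 1 - s))))⁻¹ ≠ ⊤ :=
      ENNReal.inv_ne_top.2 (ENNReal.ofReal_pos.2 (by linarith)).ne'
    finiteness
  set q : ℝ := 2 * 2 ^ ((s - m) + ((n : ℝ) + 1 - s)) *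
    ((ω.toReal ^ ((n : ℝ)⁻¹)) ^ ((n : ℝ) - s) / ω.toReal) with hq
  have hq0 : 0 ≤ q := by positivity
  have hKq : K * ENNReal.ofReal q ≤ ENNReal.ofReal (K.toReal * q + 1) := by
    rw [← ENNReal.ofReal_toReal hKtop, ← ENNReal.ofReal_mul ENNReal.toReal_nonneg,
      ENNReal.toReal_ofReal ENNReal.toReal_nonneg]
    exact ENNReal.ofReal_le_ofReal (by linarith)
  have hc0 : 0 < K.toReal * q + 1 := by positivity
  refine ⟨K.toReal * q + 1, hc0, fun A hA _ u D hD hdec _ => ?_⟩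
  rw [mul_comm, ← ENNReal.div_le_iff_le_mul (Or.inl (ENNReal.ofReal_pos.2 hc0).ne')
    (Or.inl ENNReal.ofReal_ne_top)]
  refine le_sInf ?_
  rintro _ ⟨lam, ⟨hlam, hJ⟩, rfl⟩
  rw [ENNReal.div_le_iff_le_mul (Or.inl (ENNReal.ofReal_pos.2 hc0).ne')
    (Or.inl ENNReal.ofReal_ne_top)]
  refine iSup_le fun x₀ => iSup_le fun r => iSup_le fun hr => ?_
  have hu : LocallyIntegrable u := by
    have := (hD.2 0 (Nat.zero_le _) Fin.elim0).1
    simpa only [hD.1] using this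
  refine (ofReal_oscQuot_le hn hu x₀ hr fun t ht hF =>
    hD.setLAverage_sub_le hn hm1 hs.2 hσ hA hdec hlam hJ x₀ hr ht hF).trans ?_
  calc _ = K * ENNReal.ofReal q * ENNReal.ofReal lam := by
        rw [mul_assoc K, ← ENNReal.ofReal_mul hq0]
        refine congrArg (fun z => K * ENNReal.ofReal z) ?_
        rw [← hω, hq]
        ring
    _ ≤ _ := by
        rw [mul_comm (ENNReal.ofReal lam)]
        gcongr
end
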